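/- The degree sequence consisting of three 7's and seventeen 5's (on 20 vertices) is not realizable by any simple planar graph. -/

import Mathlib

/-- A simple graph is planar if it has a drawing in the plane: vertices are mapped
injectively to points, every edge is drawn as a simple arc between the images of its
endpoints, arcs pass through no vertex points other than their endpoints, and two arcs
of distinct edges meet only in common endpoints (no crossings). -/
def SimpleGraph.IsPlanar {V : Type*} (G : SimpleGraph V) : Prop :=
  ∃ (p : V → ℝ × ℝ) (a : ∀ u v, G.Adj u v → _root_.Path (p u) (p v)),
    Function.Injective p ∧
    (∀ u v (h : G.Adj u v), Function.Injective (a u v h)) ∧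
    (∀ u v (h : G.Adj u v) (w : V), p w ∈ Set.range (a u v h) → w = u ∨ w = v) ∧
    (∀ u v (h : G.Adj u v) u' v' (h' : G.Adj u' v'), s(u, v) ≠ s(u', v') →
      Set.range (a u v h) ∩ Set.range (a u' v' h') ⊆
        ({p u, p v} : Set (ℝ × ℝ)) ∩ ({p u', p v'} : Set (ℝ × ℝ)))

namespace PlanarSeq

variable {V : Type*}

/-- An algebraic substitute for planarity. For a drawing in the plane, `k v x y` is the parity of
the winding of the edge `xy` around the vertex `v`, relative to the principal arguments, and
`i u x` is the parity of the half-turns between the principal arguments of the two directions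
of the segment joining `u` and `x`. -/
def HT (G : SimpleGraph V) : Prop :=
  ∃ (i : V → V → ZMod 2) (k : V → V → V → ZMod 2),
    (∀ u x u' x', G.Adj u u' → G.Adj x x' → u ≠ x → i u x + i x u = 1) ∧
    ∀ u v x y, G.Adj u v → G.Adj x y → u ≠ x → u ≠ y → v ≠ x → v ≠ y →
      k u x y + k v x y + k x u v + k y u v = i u x + i u y + i v x + i v y

section Topology

open Complex

theorem exists_winding {F : ℝ → ℂ} {w₀ w₁ : ℂ} (h₀ : F 0 = w₀) (h₁ : F 1 = w₁) (hw₀ : w₀ ≠ 0)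
    (hw₁ : w₁ ≠ 0) :
    ∃ k : ℤ, ∀ Φ : ℝ → ℂ, Continuous Φ → (∀ t, exp (Φ t) = F t) →
      Φ 1 - Φ 0 = log w₁ - log w₀ + k * (2 * Real.pi * I) := by
  by_cases hex : ∃ Φ : ℝ → ℂ, Continuous Φ ∧ ∀ t, exp (Φ t) = F t
  · obtain ⟨Φ, hΦ, hF⟩ := hex
    have e₀ : exp (Φ 0) = exp (log w₀) := by rw [hF, h₀, exp_log hw₀]
    have e₁ : exp (Φ 1) = exp (log w₁) := by rw [hF, h₁, exp_log hw₁]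
    obtain ⟨m, hm⟩ := exp_eq_exp_iff_exists_int.1 e₀
    obtain ⟨n, hn⟩ := exp_eq_exp_iff_exists_int.1 e₁
    refine ⟨n - m, fun Ψ hΨ hG ↦ ?_⟩
    obtain ⟨l, hl⟩ := exp_eq_exp_iff_exists_int.1 ((hG 0).trans (hF 0).symm)
    have key : Ψ = fun t ↦ Φ t + l * (2 * Real.pi * I) := by
      have cov := isCoveringMap_exp
      refine cov.eq_of_comp_eq hΨ (by fun_prop) ?_ 0 hl
      ext t
      simp only [Function.comp, hG]
      rw [← hF, eq_comm, exp_eq_exp_iff_exists_int]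
      exact ⟨l, rfl⟩
    rw [key]
    push_cast
    rw [hm, hn]
    ring
  · exact ⟨0, fun Φ hΦ h ↦ (hex ⟨Φ, hΦ, h⟩).elim⟩

theorem exists_lift_exp (F : ℝ × ℝ → ℂ) (hF : Continuous F) (h0 : ∀ z, F z ≠ 0) :
    ∃ Φ : ℝ × ℝ → ℂ, Continuous Φ ∧ ∀ z, exp (Φ z) = F z := by
  obtain ⟨f, ⟨-, hf⟩, -⟩ := isCoveringMapOn_exp.existsUnique_continuousMap_lifts
    (A := ℝ × ℝ) ⟨F, hF⟩ (a₀ := 0) (exp_log (h0 0)) h0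
  exact ⟨f, f.continuous, fun z ↦ congrFun hf z⟩

theorem exists_half_turns {z : ℂ} (hz : z ≠ 0) :
    ∃ j : ℤ, log z - log (-z) = (2 * j + 1) * (Real.pi * I) := by
  have h : exp (log z) = exp (log (-z) + Real.pi * I) := by
    rw [exp_add, exp_log hz, exp_log (neg_ne_zero.2 hz), exp_pi_mul_I]; ring
  obtain ⟨n, hn⟩ := exp_eq_exp_iff_exists_int.1 h
  exact ⟨n, by rw [hn]; ring⟩

theorem eq_of_mul_pi_I {m n : ℤ} (h : (m : ℂ) * (Real.pi * I) = n * (Real.pi * I)) : m = n := by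
  have h0 : (Real.pi * I : ℂ) ≠ 0 := by simp [Real.pi_ne_zero]
  exact_mod_cast mul_right_cancel₀ h0 h

/-- Two disjoint arcs wind consistently around each other's end points. -/
theorem winding_relation {a b : ℝ → ℂ} (ha : Continuous a) (hb : Continuous b)
    (hab : ∀ s t, a s ≠ b t) {ku kv kx ky jux juy jvx jvy : ℤ}
    (hku : ∀ Φ : ℝ → ℂ, Continuous Φ → (∀ t, exp (Φ t) = b t - a 0) →
      Φ 1 - Φ 0 = log (b 1 - a 0) - log (b 0 - a 0) + ku * (2 * Real.pi * I))
    (hkv : ∀ Φ : ℝ → ℂ, Continuous Φ → (∀ t, exp (Φ t) = b t - a 1) →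
      Φ 1 - Φ 0 = log (b 1 - a 1) - log (b 0 - a 1) + kv * (2 * Real.pi * I))
    (hkx : ∀ Φ : ℝ → ℂ, Continuous Φ → (∀ t, exp (Φ t) = a t - b 0) →
      Φ 1 - Φ 0 = log (a 1 - b 0) - log (a 0 - b 0) + kx * (2 * Real.pi * I))
    (hky : ∀ Φ : ℝ → ℂ, Continuous Φ → (∀ t, exp (Φ t) = a t - b 1) →
      Φ 1 - Φ 0 = log (a 1 - b 1) - log (a 0 - b 1) + ky * (2 * Real.pi * I))
    (hux : log (b 0 - a 0) - log (a 0 - b 0) = (2 * jux + 1) * (Real.pi * I))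
    (huy : log (b 1 - a 0) - log (a 0 - b 1) = (2 * juy + 1) * (Real.pi * I))
    (hvx : log (b 0 - a 1) - log (a 1 - b 0) = (2 * jvx + 1) * (Real.pi * I))
    (hvy : log (b 1 - a 1) - log (a 1 - b 1) = (2 * jvy + 1) * (Real.pi * I)) :
    ((ku + kv + kx + ky : ℤ) : ZMod 2) = ((jux + juy + jvx + jvy : ℤ) : ZMod 2) := by
  obtain ⟨Φ, hΦ, hexp⟩ := exists_lift_exp (fun z ↦ a z.1 - b z.2) (by fun_prop)
    (fun z ↦ sub_ne_zero.2 (hab _ _))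
  have neg : ∀ z w : ℂ, exp (z - Real.pi * I) = -w ↔ exp z = w := by
    intro z w
    rw [exp_sub, exp_pi_mul_I, div_neg, div_one, neg_inj]
  have e1 := hkx (fun s ↦ Φ (s, 0)) (by fun_prop) (fun t ↦ hexp (t, 0))
  have e2 := hky (fun s ↦ Φ (s, 1)) (by fun_prop) (fun t ↦ hexp (t, 1))
  have e3 := hku (fun t ↦ Φ (0, t) - Real.pi * I) (by fun_prop)
    (fun t ↦ by simpa only [neg_sub] using (neg _ _).2 (hexp (0, t)))
  have e4 := hkv (fun t ↦ Φ (1, t) - Real.pi * I) (by fun_prop)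
    (fun t ↦ by simpa only [neg_sub] using (neg _ _).2 (hexp (1, t)))
  have key : -2 * (ku + ky - kx - kv) + 2 * (jux - juy - jvx + jvy) = 0 := by
    apply eq_of_mul_pi_I
    push_cast
    linear_combination -e1 + e2 + e3 - e4 - hux + huy + hvx - hvy
  have : ku + kv + kx + ky = jux + juy + jvx + jvy + 2 * (kx + kv - juy - jvx) := by linarith
  rw [this]
  push_cast
  rw [show (2 : ZMod 2) = 0 from rfl]
  ring

theorem ht_of_isPlanar [LinearOrder V] {G : SimpleGraph V} (hG : G.IsPlanar) : HT G := by
  obtain ⟨p, a, hp, -, hav, haa⟩ := hG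
  let e : ℝ × ℝ → ℂ := fun z ↦ Complex.equivRealProdCLM.symm z
  have he : Function.Injective e := Complex.equivRealProdCLM.symm.injective
  have hec : Continuous e := Complex.equivRealProdCLM.symm.continuous
  let P : V → ℂ := fun v ↦ e (p v)
  have hP : ∀ {u v}, u ≠ v → P u - P v ≠ 0 := fun h ↦ sub_ne_zero.2 (fun h' ↦ h (hp (he h')))
  let c : ∀ u v, G.Adj u v → ℝ → ℂ := fun u v h t ↦ e ((a u v h).extend t)
  have hc : ∀ u v h, Continuous (c u v h) := fun u v h ↦ by
    exact hec.comp (a u v h).continuous_extend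
  have hc0 : ∀ u v h, c u v h 0 = P u := fun u v h ↦ by simp [c, P]
  have hc1 : ∀ u v h, c u v h 1 = P v := fun u v h ↦ by simp [c, P]
  have hdisj : ∀ u v (h : G.Adj u v) x y (h' : G.Adj x y), u ≠ x → u ≠ y → v ≠ x → v ≠ y →
      ∀ s t, c u v h s ≠ c x y h' t := by
    intro u v h x y h' hux huy hvx hvy s t hst
    have hne : s(u, v) ≠ s(x, y) := by
      intro h''
      rcases Sym2.eq_iff.1 h'' with ⟨h1, -⟩ | ⟨h1, -⟩
      exacts [hux h1, huy h1]
    have hst := he hst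
    have m1 : (a u v h).extend s ∈ Set.range (a u v h) := by
      rw [← _root_.Path.extend_range]; exact ⟨s, rfl⟩
    have m2 : (a u v h).extend s ∈ Set.range (a x y h') := by
      rw [hst, ← _root_.Path.extend_range]; exact ⟨t, rfl⟩
    obtain ⟨h1, h2⟩ := haa u v h x y h' hne ⟨m1, m2⟩
    simp only [Set.mem_insert_iff, Set.mem_singleton_iff] at h1 h2
    rcases h1 with h1 | h1 <;> rw [h1] at h2 <;> rcases h2 with h2 | h2
    exacts [hux (hp h2), huy (hp h2), hvx (hp h2), hvy (hp h2)]
  have hk : ∀ v x y, ∃ k : ℤ, ∀ h : G.Adj x y, v ≠ x → v ≠ y → ∀ Φ : ℝ → ℂ, Continuous Φ →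
      (∀ t, exp (Φ t) = c x y h t - P v) →
      Φ 1 - Φ 0 = log (P y - P v) - log (P x - P v) + k * (2 * Real.pi * I) := by
    intro v x y
    by_cases h : G.Adj x y ∧ v ≠ x ∧ v ≠ y
    · obtain ⟨k, hk⟩ := exists_winding (F := fun t ↦ c x y h.1 t - P v) (by rw [hc0])
        (by rw [hc1]) (hP h.2.1.symm) (hP h.2.2.symm)
      exact ⟨k, fun _ _ _ ↦ hk⟩
    · exact ⟨0, fun h1 h2 h3 ↦ (h ⟨h1, h2, h3⟩).elim⟩
  have hj : ∀ u x, ∃ j : ℤ, u ≠ x →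
      log (P x - P u) - log (P u - P x) = (2 * j + 1) * (Real.pi * I) := by
    intro u x
    by_cases h : u = x
    · exact ⟨0, fun h' ↦ (h' h).elim⟩
    · obtain ⟨j, hj⟩ := exists_half_turns (hP (Ne.symm h))
      rw [neg_sub] at hj
      exact ⟨j, fun _ ↦ hj⟩
  choose k hk using hk
  choose j hj using hj
  have symm : ∀ u x, u ≠ x → ((j u x : ℤ) : ZMod 2) + (j x u : ℤ) = 1 := by
    intro u x h
    have h1 := hj u x h
    have h2 := hj x u h.symm
    have : 2 * j u x + 1 + (2 * j x u + 1) = 0 := by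
      apply eq_of_mul_pi_I
      push_cast
      linear_combination -h1 - h2
    have h3 : j u x + j x u = -1 := by linarith
    rw [← Int.cast_add, h3]
    rfl
  have main : ∀ u v x y (_ : G.Adj u v) (_ : G.Adj x y), u ≠ x → u ≠ y → v ≠ x → v ≠ y →
      ((k u x y + k v x y + k x u v + k y u v : ℤ) : ZMod 2) =
        ((j u x + j u y + j v x + j v y : ℤ) : ZMod 2) := by
    intro u v x y h h' hux huy hvx hvy
    refine winding_relation (hc u v h) (hc x y h') (hdisj u v h x y h' hux huy hvx hvy)
      ?_ ?_ ?_ ?_ ?_ ?_ ?_ ?_ <;> simp only [hc0, hc1]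
    · exact hk u x y h' hux huy
    · exact hk v x y h' hvx hvy
    · exact hk x u v h hux.symm hvx.symm
    · exact hk y u v h huy.symm hvy.symm
    · exact hj u x hux
    · exact hj u y huy
    · exact hj v x hvx
    · exact hj v y hvy
  refine ⟨fun u x ↦ j u x, fun v x y ↦ k v (min x y) (max x y), fun u x _ _ _ _ ↦ symm u x, ?_⟩
  · intro u v x y h h' hux huy hvx hvy
    rcases lt_or_gt_of_ne h.ne with huv | huv <;> rcases lt_or_gt_of_ne h'.ne with hxy | hxy <;>
      simp only [min_eq_left huv.le, max_eq_right huv.le, min_eq_right huv.le, max_eq_left huv.le,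
        min_eq_left hxy.le, max_eq_right hxy.le, min_eq_right hxy.le, max_eq_left hxy.le]
    · have := main u v x y h h' hux huy hvx hvy
      push_cast at this
      exact this
    · have := main u v y x h h'.symm huy hux hvy hvx
      push_cast at this
      linear_combination this
    · have := main v u x y h.symm h' hvx hvy hux huy
      push_cast at this
      linear_combination this
    · have := main v u y x h.symm h'.symm hvy hvx huy hux
      push_cast at this
      linear_combination this

end Topology

end PlanarSeq

namespace PlanarSeq

variable {V : Type*} {G : SimpleGraph V}

/-- `B` induces a connected (or empty) subgraph: a property that holds somewhere on `B` and
spreads along the edges inside `B` holds on all of `B`. -/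
def Conn (G : SimpleGraph V) (B : Set V) : Prop :=
  ∀ P : V → Prop, (∃ a ∈ B, P a) → (∀ x ∈ B, ∀ y ∈ B, G.Adj x y → P x → P y) → ∀ b ∈ B, P b

theorem Conn.exists_walk {B : Set V} (h : Conn G B) {a b : V} (ha : a ∈ B) (hb : b ∈ B) :
    ∃ p : G.Walk a b, ∀ x ∈ p.support, x ∈ B := by
  refine h (fun b ↦ ∃ p : G.Walk a b, ∀ x ∈ p.support, x ∈ B) ⟨a, ha, .nil, by simpa⟩ ?_ b hb
  rintro x - y hy hxy ⟨p, hp⟩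
  refine ⟨p.concat hxy, fun z hz ↦ ?_⟩
  rw [SimpleGraph.Walk.support_concat, List.mem_append] at hz
  rcases hz with hz | hz
  · exact hp z hz
  · rwa [List.mem_singleton.1 hz]

theorem conn_singleton (a : V) : Conn G {a} := by
  rintro P ⟨b, rfl, hb⟩ - c rfl
  exact hb

theorem Conn.union {A B : Set V} (hA : Conn G A) (hB : Conn G B) {a b : V} (ha : a ∈ A)
    (hb : b ∈ B) (hab : G.Adj a b) : Conn G (A ∪ B) := by
  rintro P ⟨c, hc, hPc⟩ hP
  have keyA : (∃ x ∈ A, P x) → ∀ x ∈ A, P x := fun h ↦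
    hA P h fun x hx y hy ↦ hP x (.inl hx) y (.inl hy)
  have keyB : (∃ x ∈ B, P x) → ∀ x ∈ B, P x := fun h ↦
    hB P h fun x hx y hy ↦ hP x (.inr hx) y (.inr hy)
  rcases hc with hc | hc
  · have h1 := keyA ⟨c, hc, hPc⟩
    have h2 := keyB ⟨b, hb, hP a (.inl ha) b (.inr hb) hab (h1 a ha)⟩
    rintro x (hx | hx)
    exacts [h1 x hx, h2 x hx]
  · have h2 := keyB ⟨c, hc, hPc⟩
    have h1 := keyA ⟨a, ha, hP b (.inr hb) a (.inl ha) hab.symm (h2 b hb)⟩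
    rintro x (hx | hx)
    exacts [h1 x hx, h2 x hx]

theorem Conn.insert {B : Set V} (hB : Conn G B) {a b : V} (hb : b ∈ B) (hab : G.Adj a b) :
    Conn G (insert a B) := by
  rw [Set.insert_eq]
  exact (conn_singleton a).union hB rfl hb hab

/-- The component of `a` in the subgraph induced by `X`. -/
def comp (G : SimpleGraph V) (X : Set V) (a : V) : Set V :=
  {b | Relation.ReflTransGen (fun x y ↦ G.Adj x y ∧ x ∈ X ∧ y ∈ X) a b}

theorem self_mem_comp (X : Set V) (a : V) : a ∈ comp G X a := Relation.ReflTransGen.refl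

theorem comp_subset {X : Set V} {a : V} (ha : a ∈ X) : comp G X a ⊆ X := by
  intro b hb
  induction hb with
  | refl => exact ha
  | tail _ h _ => exact h.2.2

theorem mem_comp_of_adj {X : Set V} {a b c : V} (ha : a ∈ X) (hb : b ∈ comp G X a)
    (hbc : G.Adj b c) (hc : c ∈ X) : c ∈ comp G X a :=
  Relation.ReflTransGen.tail hb ⟨hbc, comp_subset ha hb, hc⟩

theorem conn_comp {X : Set V} (a : V) : Conn G (comp G X a) := by
  rintro P ⟨b, hb, hPb⟩ hP
  have mem : ∀ x y, x ∈ comp G X a → G.Adj x y → x ∈ X → y ∈ X → y ∈ comp G X a :=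
    fun x y hx h h1 h2 ↦ Relation.ReflTransGen.tail hx ⟨h, h1, h2⟩
  have hsymm : Std.Symm fun x y ↦ G.Adj x y ∧ x ∈ X ∧ y ∈ X :=
    ⟨fun x y h ↦ ⟨h.1.symm, h.2.2, h.2.1⟩⟩
  intro c hc
  have hbc := (Relation.ReflTransGen.stdSymm.symm _ _ hb).trans hc
  have : P c ∧ c ∈ comp G X a := by
    induction hbc with
    | refl => exact ⟨hPb, hb⟩
    | @tail x y hbx hxy ih =>
      have hx := hb.trans hbx
      have hy := mem x y hx hxy.1 hxy.2.1 hxy.2.2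
      exact ⟨hP x hx y hy hxy.1 (ih hx).1, hy⟩
  exact this.1

section Model

variable {i : V → V → ZMod 2} {k : V → V → V → ZMod 2}

/-- The winding parity of a walk around `z`. -/
def wind (k : V → V → V → ZMod 2) (z : V) : ∀ {a b : V}, G.Walk a b → ZMod 2
  | _, _, .nil => 0
  | a, _, .cons (v := c) _ p => k z a c + wind k z p

theorem wind_edge (hk : ∀ u v x y, G.Adj u v → G.Adj x y → u ≠ x → u ≠ y → v ≠ x → v ≠ y →
      k u x y + k v x y + k x u v + k y u v = i u x + i u y + i v x + i v y)
    {x y : V} (hxy : G.Adj x y) {a b : V} (p : G.Walk a b) (hx : x ∉ p.support)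
    (hy : y ∉ p.support) :
    wind k x p + wind k y p + k a x y + k b x y = i a x + i a y + i b x + i b y := by
  induction p with
  | nil => simp only [wind]; grind
  | @cons a c b h p ih =>
    simp only [SimpleGraph.Walk.support_cons, List.mem_cons, not_or] at hx hy
    have h1 := ih hx.2 hy.2
    have hc := p.start_mem_support
    have h2 := hk a c x y h hxy (Ne.symm hx.1) (Ne.symm hy.1) (fun h ↦ hx.2 (h ▸ hc))
      (fun h ↦ hy.2 (h ▸ hc))
    simp only [wind]
    grind

theorem wind_walk (hk : ∀ u v x y, G.Adj u v → G.Adj x y → u ≠ x → u ≠ y → v ≠ x → v ≠ y →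
      k u x y + k v x y + k x u v + k y u v = i u x + i u y + i v x + i v y)
    {a b : V} (p : G.Walk a b) {c d : V} (q : G.Walk c d)
    (hpq : ∀ z, z ∈ p.support → z ∉ q.support) :
    wind k a q + wind k b q + wind k c p + wind k d p = i a c + i a d + i b c + i b d := by
  induction q with
  | nil => simp only [wind]; grind
  | @cons c e d h q ih =>
    simp only [SimpleGraph.Walk.support_cons, List.mem_cons, not_or] at hpq
    have h1 := ih (fun z hz ↦ (hpq z hz).2)
    have h2 := wind_edge hk h p (fun h ↦ (hpq _ h).1 rfl)
      (fun h ↦ (hpq _ h).2 q.start_mem_support)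
    simp only [wind]
    grind

theorem HT.of_model {W : Type*} {H : SimpleGraph W} (hG : HT G) (B : W → Set V)
    (hconn : ∀ w, Conn G (B w)) (hdisj : ∀ w w' z, z ∈ B w → z ∈ B w' → w = w')
    (hadj : ∀ w w', H.Adj w w' → ∃ a ∈ B w, ∃ b ∈ B w', G.Adj a b) : HT H := by
  classical
  rcases isEmpty_or_nonempty V with hV | ⟨⟨v₀⟩⟩
  · exact ⟨0, 0, fun u x u' x' h ↦ (hV.false (hadj u u' h).choose).elim,
      fun u v x y h ↦ (hV.false (hadj u v h).choose).elim⟩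
  obtain ⟨i, k, hi, hk⟩ := hG
  have hb : ∀ w, ∃ b, ∀ w', H.Adj w w' → b ∈ B w ∧ ∃ c, G.Adj b c := by
    intro w
    by_cases h : ∃ w', H.Adj w w'
    · obtain ⟨w', h⟩ := h
      obtain ⟨a, ha, c, -, hac⟩ := hadj w w' h
      exact ⟨a, fun _ _ ↦ ⟨ha, c, hac⟩⟩
    · exact ⟨v₀, fun w' hw' ↦ (h ⟨w', hw'⟩).elim⟩
  choose b hb using hb
  have hwalk : ∀ w w', H.Adj w w' → ∃ p : G.Walk (b w) (b w'),
      ∀ z ∈ p.support, z ∈ B w ∨ z ∈ B w' := by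
    intro w w' h
    obtain ⟨x, hx, y, hy, hxy⟩ := hadj w w' h
    exact ((hconn w).union (hconn w') hx hy hxy).exists_walk (.inl (hb w w' h).1)
      (.inr (hb w' w h.symm).1)
  choose p hp using hwalk
  refine ⟨fun u x ↦ i (b u) (b x), fun z x y ↦ if h : H.Adj x y then wind k (b z) (p x y h) else 0,
    fun u x u' x' hu hx hux ↦ ?_, ?_⟩
  · obtain ⟨hu, c, hc⟩ := hb u u' hu
    obtain ⟨hx, d, hd⟩ := hb x x' hx
    exact hi _ _ c d hc hd fun h ↦ hux (hdisj u x (b u) hu (h ▸ hx))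
  intro u v x y huv hxy hux huy hvx hvy
  simp only [huv, hxy, dif_pos]
  refine wind_walk hk (p u v huv) (p x y hxy) fun z hz hz' ↦ ?_
  rcases hp u v huv z hz with h | h <;> rcases hp x y hxy z hz' with h' | h'
  exacts [hux (hdisj _ _ z h h'), huy (hdisj _ _ z h h'), hvx (hdisj _ _ z h h'),
    hvy (hdisj _ _ z h h')]

theorem HT.mono {H : SimpleGraph V} (hG : HT G) (h : H ≤ G) : HT H := by
  obtain ⟨i, k, hi, hk⟩ := hG
  exact ⟨i, k, fun u x u' x' h1 h2 ↦ hi u x u' x' (h h1) (h h2),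
    fun u v x y h1 h2 ↦ hk u v x y (h h1) (h h2)⟩

end Model

section Kuratowski

theorem not_ht_K5 : ¬ HT (⊤ : SimpleGraph (Fin 5)) := by
  rintro ⟨i, k, hi, hk⟩
  simp only [SimpleGraph.top_adj] at hi hk
  have e1 := hk 0 1 2 3 (by decide) (by decide) (by decide) (by decide) (by decide) (by decide)
  have e2 := hk 0 1 2 4 (by decide) (by decide) (by decide) (by decide) (by decide) (by decide)
  have e3 := hk 0 1 3 4 (by decide) (by decide) (by decide) (by decide) (by decide) (by decide)
  have e4 := hk 0 2 1 3 (by decide) (by decide) (by decide) (by decide) (by decide) (by decide)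
  have e5 := hk 0 2 1 4 (by decide) (by decide) (by decide) (by decide) (by decide) (by decide)
  have e6 := hk 0 2 3 4 (by decide) (by decide) (by decide) (by decide) (by decide) (by decide)
  have e7 := hk 0 3 1 2 (by decide) (by decide) (by decide) (by decide) (by decide) (by decide)
  have e8 := hk 0 3 1 4 (by decide) (by decide) (by decide) (by decide) (by decide) (by decide)
  have e9 := hk 0 3 2 4 (by decide) (by decide) (by decide) (by decide) (by decide) (by decide)
  have e10 := hk 0 4 1 2 (by decide) (by decide) (by decide) (by decide) (by decide) (by decide)
  have e11 := hk 0 4 1 3 (by decide) (by decide) (by decide) (by decide) (by decide) (by decide)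
  have e12 := hk 0 4 2 3 (by decide) (by decide) (by decide) (by decide) (by decide) (by decide)
  have e13 := hk 1 2 3 4 (by decide) (by decide) (by decide) (by decide) (by decide) (by decide)
  have e14 := hk 1 3 2 4 (by decide) (by decide) (by decide) (by decide) (by decide) (by decide)
  have e15 := hk 1 4 2 3 (by decide) (by decide) (by decide) (by decide) (by decide) (by decide)
  have a0 := hi 1 2 0 0 (by decide) (by decide) (by decide)
  have a1 := hi 1 3 0 0 (by decide) (by decide) (by decide)
  have a2 := hi 2 3 0 0 (by decide) (by decide) (by decide)
  have a3 := hi 2 4 0 0 (by decide) (by decide) (by decide)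
  have a4 := hi 3 4 0 0 (by decide) (by decide) (by decide)
  grind

/-- The complete bipartite graph with sides `{0, 1, 2}` and `{3, 4, 5}`. -/
def K33 : SimpleGraph (Fin 6) where
  Adj a b := (a < 3 ∧ 3 ≤ b) ∨ (b < 3 ∧ 3 ≤ a)
  symm := ⟨fun _ _ h ↦ Or.symm h⟩
  loopless := ⟨fun a h ↦ by rcases h with h | h <;> exact absurd h.1 (not_lt.2 h.2)⟩

theorem not_ht_K33 : ¬ HT K33 := by
  rintro ⟨i, k, hi, hk⟩
  simp only [K33] at hi hk
  have e1 := hk 0 3 1 4 (by decide) (by decide) (by decide) (by decide) (by decide) (by decide)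
  have e2 := hk 0 3 1 5 (by decide) (by decide) (by decide) (by decide) (by decide) (by decide)
  have e3 := hk 0 3 2 4 (by decide) (by decide) (by decide) (by decide) (by decide) (by decide)
  have e4 := hk 0 3 2 5 (by decide) (by decide) (by decide) (by decide) (by decide) (by decide)
  have e5 := hk 0 4 1 3 (by decide) (by decide) (by decide) (by decide) (by decide) (by decide)
  have e6 := hk 0 4 1 5 (by decide) (by decide) (by decide) (by decide) (by decide) (by decide)
  have e7 := hk 0 4 2 3 (by decide) (by decide) (by decide) (by decide) (by decide) (by decide)
  have e8 := hk 0 4 2 5 (by decide) (by decide) (by decide) (by decide) (by decide) (by decide)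
  have e9 := hk 0 5 1 3 (by decide) (by decide) (by decide) (by decide) (by decide) (by decide)
  have e10 := hk 0 5 1 4 (by decide) (by decide) (by decide) (by decide) (by decide) (by decide)
  have e11 := hk 0 5 2 3 (by decide) (by decide) (by decide) (by decide) (by decide) (by decide)
  have e12 := hk 0 5 2 4 (by decide) (by decide) (by decide) (by decide) (by decide) (by decide)
  have e13 := hk 1 3 2 4 (by decide) (by decide) (by decide) (by decide) (by decide) (by decide)
  have e14 := hk 1 3 2 5 (by decide) (by decide) (by decide) (by decide) (by decide) (by decide)
  have e15 := hk 1 4 2 3 (by decide) (by decide) (by decide) (by decide) (by decide) (by decide)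
  have e16 := hk 1 4 2 5 (by decide) (by decide) (by decide) (by decide) (by decide) (by decide)
  have e17 := hk 1 5 2 3 (by decide) (by decide) (by decide) (by decide) (by decide) (by decide)
  have e18 := hk 1 5 2 4 (by decide) (by decide) (by decide) (by decide) (by decide) (by decide)
  have a0 := hi 0 1 3 3 (by decide) (by decide) (by decide)
  have a1 := hi 0 2 3 3 (by decide) (by decide) (by decide)
  have a2 := hi 0 3 3 0 (by decide) (by decide) (by decide)
  have a3 := hi 0 4 3 0 (by decide) (by decide) (by decide)
  have a4 := hi 0 5 3 0 (by decide) (by decide) (by decide)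
  have a5 := hi 1 2 3 3 (by decide) (by decide) (by decide)
  have a6 := hi 1 3 3 0 (by decide) (by decide) (by decide)
  have a7 := hi 1 4 3 0 (by decide) (by decide) (by decide)
  have a8 := hi 1 5 3 0 (by decide) (by decide) (by decide)
  have a9 := hi 2 3 3 0 (by decide) (by decide) (by decide)
  have a10 := hi 2 4 3 0 (by decide) (by decide) (by decide)
  have a11 := hi 2 5 3 0 (by decide) (by decide) (by decide)
  have a12 := hi 3 4 0 0 (by decide) (by decide) (by decide)
  have a13 := hi 3 5 0 0 (by decide) (by decide) (by decide)
  have a14 := hi 4 5 0 0 (by decide) (by decide) (by decide)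
  grind

theorem HT.false_of_K5 (hG : HT G) (B : Fin 5 → Set V)
    (hconn : ∀ w, Conn G (B w)) (hdisj : ∀ w w' z, w < w' → z ∈ B w → z ∉ B w')
    (hadj : ∀ w w', w < w' → ∃ a ∈ B w, ∃ b ∈ B w', G.Adj a b) : False := by
  refine not_ht_K5 (hG.of_model B hconn (fun w w' z hz hz' ↦ ?_) fun w w' h ↦ ?_)
  · rcases lt_trichotomy w w' with h | h | h
    exacts [(hdisj w w' z h hz hz').elim, h, (hdisj w' w z h hz' hz).elim]
  · rcases lt_or_gt_of_ne h.ne with h | h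
    · exact hadj w w' h
    · obtain ⟨a, ha, b, hb, hab⟩ := hadj w' w h
      exact ⟨b, hb, a, ha, hab.symm⟩

theorem HT.false_of_K33 (hG : HT G) (B : Fin 6 → Set V)
    (hconn : ∀ w, Conn G (B w)) (hdisj : ∀ w w' z, w < w' → z ∈ B w → z ∉ B w')
    (hadj : ∀ w w', w < 3 → 3 ≤ w' → ∃ a ∈ B w, ∃ b ∈ B w', G.Adj a b) : False := by
  refine not_ht_K33 (hG.of_model B hconn (fun w w' z hz hz' ↦ ?_) fun w w' h ↦ ?_)
  · rcases lt_trichotomy w w' with h | h | h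
    exacts [(hdisj w w' z h hz hz').elim, h, (hdisj w' w z h hz' hz).elim]
  · rcases h with h | h
    · exact hadj w w' h.1 h.2
    · obtain ⟨a, ha, b, hb, hab⟩ := hadj w' w h.1 h.2
      exact ⟨b, hb, a, ha, hab.symm⟩

end Kuratowski

end PlanarSeq

namespace PlanarSeq

open scoped Classical

variable {V : Type*} {G : SimpleGraph V}

section Counting

/-- The number of pairs in `A × B` that are adjacent. -/
noncomputable def e (G : SimpleGraph V) (A B : Finset V) : ℕ :=
  ∑ a ∈ A, ∑ b ∈ B, if G.Adj a b then 1 else 0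

/-- The neighbours of `v` in `Y`. -/
noncomputable def nb (G : SimpleGraph V) (Y : Finset V) (v : V) : Finset V :=
  {x ∈ Y | G.Adj v x}

@[simp] theorem mem_nb {Y : Finset V} {v x : V} : x ∈ nb G Y v ↔ x ∈ Y ∧ G.Adj v x := by
  simp [nb]

theorem e_eq_sum_card (A B : Finset V) : e G A B = ∑ a ∈ A, (nb G B a).card := by
  simp [e, nb]

theorem e_comm (A B : Finset V) : e G A B = e G B A := by
  unfold e
  rw [Finset.sum_comm]
  simp only [G.adj_comm]

theorem e_union_left {A A' : Finset V} (h : Disjoint A A') (B : Finset V) :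
    e G (A ∪ A') B = e G A B + e G A' B := Finset.sum_union h

theorem e_union_right {B B' : Finset V} (h : Disjoint B B') (A : Finset V) :
    e G A (B ∪ B') = e G A B + e G A B' := by
  rw [e_comm, e_union_left h, e_comm B, e_comm B']

theorem e_union {A B : Finset V} (h : Disjoint A B) :
    e G (A ∪ B) (A ∪ B) = e G A A + 2 * e G A B + e G B B := by
  rw [e_union_left h, e_union_right h, e_union_right h, e_comm B A]
  ring

@[simp] theorem e_singleton_left (a : V) (B : Finset V) : e G {a} B = (nb G B a).card := by
  rw [e_eq_sum_card, Finset.sum_singleton]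

theorem nb_singleton_self (a : V) : nb G {a} a = ∅ := by
  ext x
  simp only [mem_nb, Finset.mem_singleton, Finset.notMem_empty, iff_false, not_and]
  rintro rfl
  exact G.loopless.irrefl x

theorem e_insert {a : V} {A : Finset V} (h : a ∉ A) :
    e G (insert a A) (insert a A) = e G A A + 2 * (nb G A a).card := by
  rw [Finset.insert_eq, e_union (Finset.disjoint_singleton_left.2 h), e_singleton_left,
    e_singleton_left, nb_singleton_self, Finset.card_empty]
  ring

theorem e_congr {H : SimpleGraph V} {A B : Finset V}
    (h : ∀ a ∈ A, ∀ b ∈ B, (G.Adj a b ↔ H.Adj a b)) : e G A B = e H A B := by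
  refine Finset.sum_congr rfl fun a ha ↦ Finset.sum_congr rfl fun b hb ↦ ?_
  simp only [h a ha b hb]

theorem e_self_le (A : Finset V) : e G A A ≤ A.card * (A.card - 1) := by
  rw [e_eq_sum_card]
  refine Finset.sum_le_card_nsmul _ _ _ fun a ha ↦ ?_
  rw [← Finset.card_erase_of_mem ha]
  exact Finset.card_le_card fun x hx ↦
    Finset.mem_erase.2 ⟨(mem_nb.1 hx).2.ne', (mem_nb.1 hx).1⟩

theorem e_pair {A : Finset V} {u v : V} (hu : u ∉ A) (hv : v ∉ A) (h : G.Adj u v) :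
    e G (insert u (insert v A)) (insert u (insert v A)) =
      e G A A + 2 * (nb G A u).card + 2 * (nb G A v).card + 2 := by
  have hu' : u ∉ insert v A := by simp [h.ne, hu]
  have h1 : nb G (insert v A) u = insert v (nb G A u) := by
    ext x
    simp only [mem_nb, Finset.mem_insert]
    constructor
    · rintro ⟨rfl | hx, hx'⟩
      exacts [.inl rfl, .inr ⟨hx, hx'⟩]
    · rintro (rfl | hx)
      exacts [⟨.inl rfl, h⟩, ⟨.inr hx.1, hx.2⟩]
  rw [e_insert hu', e_insert hv, h1, Finset.card_insert_of_notMem (by simp [hv])]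
  ring

end Counting

section Hub

/-- The graph in which `X` is collapsed to its element `x₀`, the other elements of `X` becoming
isolated. -/
def hub (G : SimpleGraph V) (X : Set V) (x₀ : V) : SimpleGraph V where
  Adj a b := a ≠ b ∧ (a = x₀ ∨ a ∉ X) ∧ (b = x₀ ∨ b ∉ X) ∧
    (G.Adj a b ∨ (a = x₀ ∧ ∃ x ∈ X, G.Adj x b) ∨ (b = x₀ ∧ ∃ x ∈ X, G.Adj x a))
  symm := ⟨fun _ _ ⟨h, ha, hb, h'⟩ ↦ ⟨h.symm, hb, ha, h'.imp SimpleGraph.Adj.symm Or.symm⟩⟩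
  loopless := ⟨fun _ h ↦ h.1 rfl⟩

variable {X : Set V} {x₀ : V}

theorem hub_adj_of_notMem (hx₀ : x₀ ∈ X) {a b : V} (ha : a ∉ X) (hb : b ∉ X) :
    (hub G X x₀).Adj a b ↔ G.Adj a b := by
  have h1 : a ≠ x₀ := fun h ↦ ha (h ▸ hx₀)
  have h2 : b ≠ x₀ := fun h ↦ hb (h ▸ hx₀)
  simp only [hub, ha, hb, h1, h2, false_or, not_false_eq_true, true_and, false_and, or_false,
    and_iff_right_iff_imp]
  exact fun h ↦ h.ne

theorem hub_adj_left (hx₀ : x₀ ∈ X) {b : V} (hb : b ∉ X) :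
    (hub G X x₀).Adj x₀ b ↔ ∃ x ∈ X, G.Adj x b := by
  have h2 : b ≠ x₀ := fun h ↦ hb (h ▸ hx₀)
  simp only [hub, ne_eq, h2.symm, not_false_eq_true, true_or, hb, or_true, true_and, h2, false_and,
    or_false]
  exact ⟨fun h ↦ h.elim (fun h ↦ ⟨x₀, hx₀, h⟩) id, .inr⟩

theorem HT.ht_hub (hG : HT G) (hX : Conn G X) (hx₀ : x₀ ∈ X) : HT (hub G X x₀) := by
  refine hG.of_model (fun w ↦ if w = x₀ then X else if w ∈ X then ∅ else {w}) ?_ ?_ ?_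
  · intro w
    split_ifs
    · exact hX
    · rintro P ⟨a, ha, -⟩
      exact ha.elim
    · exact conn_singleton w
  · intro w w' z hz hz'
    split_ifs at hz hz' <;> simp_all
  · rintro a b ⟨hab, ha, hb, h⟩
    have mem : ∀ a, a = x₀ ∨ a ∉ X → a ∈ if a = x₀ then X else if a ∈ X then ∅ else {a} := by
      intro a ha
      rcases ha with rfl | ha
      · simpa
      · split_ifs with h
        · exact (ha (h ▸ hx₀)).elim
        · rfl
    rcases h with h | ⟨rfl, x, hx, h⟩ | ⟨rfl, x, hx, h⟩
    · exact ⟨a, mem a ha, b, mem b hb, h⟩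
    · exact ⟨x, by simpa, b, mem b hb, h⟩
    · exact ⟨a, mem a ha, x, by simpa, h.symm⟩

theorem e_hub (hx₀ : x₀ ∈ X) {Y : Finset V} (hY : ∀ y ∈ Y, y ∉ X) :
    e (hub G X x₀) (insert x₀ Y) (insert x₀ Y) =
      e G Y Y + 2 * (Y.filter fun y ↦ ∃ x ∈ X, G.Adj x y).card := by
  rw [e_insert (fun h ↦ hY _ h hx₀)]
  congr 1
  · exact e_congr fun a ha b hb ↦ hub_adj_of_notMem hx₀ (hY a ha) (hY b hb)
  · congr 2
    ext y
    simp only [mem_nb, Finset.mem_filter]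
    exact and_congr_right fun hy ↦ hub_adj_left hx₀ (hY y hy)

end Hub

section EdgeBound

theorem HT.false_of_K4_nbrs (hG : HT G) {v : V} (B : Fin 4 → Set V) (hv : ∀ w, v ∉ B w)
    (hconn : ∀ w, Conn G (B w)) (hdisj : ∀ w w' z, w < w' → z ∈ B w → z ∉ B w')
    (hadj : ∀ w w', w < w' → ∃ a ∈ B w, ∃ b ∈ B w', G.Adj a b)
    (hvB : ∀ w, ∃ a ∈ B w, G.Adj v a) : False := by
  refine hG.false_of_K5 (Fin.cons {v} B) (fun w ↦ ?_) (fun w w' z h hz ↦ ?_) fun w w' h ↦ ?_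
  · refine Fin.cases (conn_singleton v) (fun w ↦ hconn w) w
  · induction w' using Fin.cases with
    | zero => exact absurd h (by simp)
    | succ w' =>
      induction w using Fin.cases with
      | zero => obtain rfl := hz; exact hv w'
      | succ w => exact hdisj w w' z (Fin.succ_lt_succ_iff.1 h) hz
  · induction w' using Fin.cases with
    | zero => exact absurd h (by simp)
    | succ w' =>
      induction w using Fin.cases with
      | zero => obtain ⟨a, ha, h⟩ := hvB w'; exact ⟨v, rfl, a, ha, h⟩
      | succ w => exact hadj w w' (Fin.succ_lt_succ_iff.1 h)

theorem HT.false_of_nbrs_four (hG : HT G) {v a b c d : V} (ha : G.Adj v a) (hb : G.Adj v b)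
    (hc : G.Adj v c) (hd : G.Adj v d) (hab : G.Adj a b) (hac : G.Adj a c) (had : G.Adj a d)
    (hbc : G.Adj b c) (hbd : G.Adj b d) (hcd : G.Adj c d) : False := by
  refine hG.false_of_K4_nbrs (v := v) ![{a}, {b}, {c}, {d}] ?_ ?_ ?_ ?_ ?_
  · intro w; fin_cases w <;> simp [ha.ne, hb.ne, hc.ne, hd.ne]
  · intro w; fin_cases w <;> exact conn_singleton _
  · intro w w' z h
    fin_cases w <;> fin_cases w' <;> first | exact absurd h (by decide) | skip
    all_goals simp; rintro rfl
    exacts [hab.ne, hac.ne, had.ne, hbc.ne, hbd.ne, hcd.ne]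
  · intro w w' h
    fin_cases w <;> fin_cases w' <;> first | exact absurd h (by decide) | skip
    all_goals simpa
  · intro w; fin_cases w <;> simpa

theorem HT.false_of_nbrs_five (hG : HT G) {v a b c d x : V} (ha : G.Adj v a) (hb : G.Adj v b)
    (hc : G.Adj v c) (hd : G.Adj v d) (hx : G.Adj v x) (hax : G.Adj a x) (hab : a ≠ b)
    (hxb : G.Adj x b) (hac : G.Adj a c) (had : G.Adj a d) (hxc : x ≠ c) (hxd : x ≠ d)
    (hbc : G.Adj b c) (hbd : G.Adj b d) (hcd : G.Adj c d) : False := by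
  refine hG.false_of_K4_nbrs (v := v) ![{a, x}, {b}, {c}, {d}] ?_ ?_ ?_ ?_ ?_
  · intro w; fin_cases w <;> simp [ha.ne, hb.ne, hc.ne, hd.ne, hx.ne]
  · intro w; fin_cases w
    · exact (conn_singleton x).insert rfl hax
    all_goals exact conn_singleton _
  · intro w w' z h
    fin_cases w <;> fin_cases w' <;> first | exact absurd h (by decide) | skip
    all_goals simp
    · rintro (rfl | rfl); exacts [hab, hxb.ne]
    · rintro (rfl | rfl); exacts [hac.ne, hxc]
    · rintro (rfl | rfl); exacts [had.ne, hxd]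
    all_goals rintro rfl
    exacts [hbc.ne, hbd.ne, hcd.ne]
  · intro w w' h
    fin_cases w <;> fin_cases w' <;> first | exact absurd h (by decide) | skip
    all_goals simp [*]
  · intro w; fin_cases w <;> simp [*]

/-- A vertex of degree at most five is on an edge with at most two common neighbours. -/
theorem HT.exists_edge_of_nb_card_le (hG : HT G) {Y : Finset V} {v : V}
    (h1 : (nb G Y v).Nonempty) (h5 : (nb G Y v).card ≤ 5) :
    ∃ x ∈ nb G Y v, (nb G (nb G Y v) x).card ≤ 2 := by
  set N := nb G Y v with hN
  by_contra! hcon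
  have hv : ∀ x ∈ N, G.Adj v x := fun x hx ↦ (mem_nb.1 hx).2
  have hle : ∀ x ∈ N, insert x (nb G N x) ⊆ N := fun x hx y hy ↦ by
    rcases Finset.mem_insert.1 hy with rfl | hy
    exacts [hx, (mem_nb.1 hy).1]
  have hself : ∀ x, x ∉ nb G N x := fun x hx ↦ (mem_nb.1 hx).2.ne rfl
  -- every vertex of `N` misses at most one other vertex of `N`
  have hmiss : ∀ x ∈ N, ∀ y ∈ N, ∀ z ∈ N, x ≠ y → x ≠ z → y ≠ z → ¬ G.Adj x y → G.Adj x z := by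
    intro x hx y hy z hz hxy hxz hyz hny
    by_contra hnz
    have : (insert y (insert z (insert x (nb G N x)))).card ≤ N.card :=
      Finset.card_le_card (Finset.insert_subset hy (Finset.insert_subset hz (hle x hx)))
    rw [Finset.card_insert_of_notMem (by simp [hyz, hxy.symm, hny]),
      Finset.card_insert_of_notMem (by simp [hxz.symm, hnz]),
      Finset.card_insert_of_notMem (hself x)] at this
    have := hcon x hx
    omega
  by_cases hall : ∀ x ∈ N, ∀ y ∈ N, x ≠ y → G.Adj x y
  · obtain ⟨x, hx⟩ := h1
    obtain ⟨a, b, c, ha, hb, hc, hab, hac, hbc⟩ := Finset.two_lt_card_iff.1 (hcon x hx)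
    rw [mem_nb] at ha hb hc
    exact hG.false_of_nbrs_four (hv x hx) (hv a ha.1) (hv b hb.1) (hv c hc.1) ha.2 hb.2 hc.2
      (hall a ha.1 b hb.1 hab) (hall a ha.1 c hc.1 hac) (hall b hb.1 c hc.1 hbc)
  · push Not at hall
    obtain ⟨a, ha, b, hb, hab, hnab⟩ := hall
    obtain ⟨c, d, x, hc, hd, hx, hcd, hcx, hdx⟩ := Finset.two_lt_card_iff.1 (hcon a ha)
    rw [mem_nb] at hc hd hx
    have hbc : b ≠ c := fun h ↦ hnab (h ▸ hc.2)
    have hbd : b ≠ d := fun h ↦ hnab (h ▸ hd.2)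
    have hbx : b ≠ x := fun h ↦ hnab (h ▸ hx.2)
    have hnba : ¬ G.Adj b a := fun h ↦ hnab h.symm
    have hc' := hmiss b hb a ha c hc.1 hab.symm hbc hc.2.ne hnba
    have hd' := hmiss b hb a ha d hd.1 hab.symm hbd hd.2.ne hnba
    have hx' := hmiss b hb a ha x hx.1 hab.symm hbx hx.2.ne hnba
    by_cases h : G.Adj c d
    · exact hG.false_of_nbrs_five (hv a ha) (hv b hb) (hv c hc.1) (hv d hd.1) (hv x hx.1) hx.2 hab
        hx'.symm hc.2 hd.2 hcx.symm hdx.symm hc' hd' h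
    · have h' := hmiss c hc.1 d hd.1 x hx.1 hcd hcx hdx h
      exact hG.false_of_nbrs_five (hv a ha) (hv b hb) (hv c hc.1) (hv x hx.1) (hv d hd.1) hd.2 hab
        hd'.symm hc.2 hx.2 hcd.symm hdx hc' hx' h'

/-- The edge bound for `n` vertices. -/
def EdgeBound (V : Type*) (n : ℕ) : Prop :=
  ∀ (G : SimpleGraph V), HT G → ∀ Y : Finset V, Y.card = n → e G Y Y + 12 ≤ 6 * n

theorem EdgeBound.hub {n : ℕ} (h : EdgeBound V (n + 1)) (hG : HT G) {X : Set V} (hX : Conn G X)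
    (hX' : X.Nonempty) {Y : Finset V} (hY : ∀ y ∈ Y, y ∉ X) (hn : Y.card = n) :
    e G Y Y + 2 * (Y.filter fun y ↦ ∃ x ∈ X, G.Adj x y).card + 6 ≤ 6 * n := by
  obtain ⟨x₀, hx₀⟩ := hX'
  have := h _ (hG.ht_hub hX hx₀) (insert x₀ Y)
    (by rw [Finset.card_insert_of_notMem fun h ↦ hY _ h hx₀, hn])
  rw [e_hub hx₀ hY] at this
  omega

theorem nb_inter_card (Y : Finset V) (u v : V) :
    (nb G Y u).card + (nb G Y v).card =
      (Y.filter fun y ↦ G.Adj u y ∨ G.Adj v y).card + (nb G (nb G Y u) v).card := by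
  rw [← Finset.card_union_add_card_inter]
  congr 2
  · ext; simp; tauto
  · ext; simp; tauto

theorem EdgeBound.edge {n : ℕ} (h : EdgeBound V (n + 1)) (hG : HT G) {Y : Finset V}
    {u v : V} (huv : G.Adj u v) (hu : u ∉ Y) (hv : v ∉ Y) (hn : Y.card = n) :
    e G (insert u (insert v Y)) (insert u (insert v Y)) + 4 ≤
      6 * n + 2 * (nb G (nb G Y u) v).card := by
  have h1 := h.hub hG (X := {u, v}) ((conn_singleton v).insert rfl huv) ⟨u, by simp⟩ (Y := Y)
    (by rintro y hy (rfl | rfl); exacts [hu hy, hv hy]) hn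
  have h2 := nb_inter_card (G := G) Y u v
  rw [e_pair hu hv huv]
  simp only [Set.mem_insert_iff, Set.mem_singleton_iff, exists_eq_or_imp, exists_eq_left] at h1
  omega

theorem e_deleteEdges {u v : V} (Y : Finset V) :
    e G Y Y ≤ e (G.deleteEdges {s(u, v)}) Y Y + 2 := by
  obtain ⟨H, hH⟩ : ∃ H, H = G.deleteEdges {s(u, v)} := ⟨_, rfl⟩
  have hadj : ∀ a b, H.Adj a b ↔ G.Adj a b ∧ s(a, b) ≠ s(u, v) := by simp [hH]
  rw [← hH]
  have h : ∀ a b, (if G.Adj a b then 1 else 0) ≤ (if H.Adj a b then 1 else 0)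
      + ((if a = u then if b = v then 1 else 0 else 0)
      + (if a = v then if b = u then 1 else 0 else 0)) := by
    intro a b
    by_cases h1 : a = u <;> by_cases h2 : b = v <;> by_cases h3 : a = v <;> by_cases h4 : b = u <;>
      by_cases h5 : G.Adj a b <;> simp [hadj, h1, h2, h3, h4, h5] <;> simp_all
  have h2 : ∀ x y : V, ∑ a ∈ Y, ∑ b ∈ Y, (if a = x then if b = y then 1 else 0 else 0) ≤ 1 := by
    intro x y
    have : ∀ a ∈ Y, ∑ b ∈ Y, (if a = x then if b = y then 1 else 0 else 0) ≤
        if a = x then 1 else 0 := by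
      intro a _
      split_ifs
      · rw [Finset.sum_ite_eq']; split_ifs <;> simp
      · simp
    refine (Finset.sum_le_sum this).trans ?_
    rw [Finset.sum_ite_eq']; split_ifs <;> simp
  calc e G Y Y ≤ _ := Finset.sum_le_sum fun a _ ↦ Finset.sum_le_sum fun b _ ↦ h a b
    _ = e H Y Y + _ := by
      simp only [Finset.sum_add_distrib]; rfl
    _ ≤ _ := Nat.add_le_add_left (Nat.add_le_add (h2 u v) (h2 v u)) _

theorem e_deleteEdges_lt {u v : V} {Y : Finset V} (huv : G.Adj u v) (hu : u ∈ Y) (hv : v ∈ Y) :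
    e (G.deleteEdges {s(u, v)}) Y Y < e G Y Y := by
  obtain ⟨H, hH⟩ : ∃ H, H = G.deleteEdges {s(u, v)} := ⟨_, rfl⟩
  have hadj : ∀ a b, H.Adj a b ↔ G.Adj a b ∧ s(a, b) ≠ s(u, v) := by simp [hH]
  rw [← hH]
  have h : ∀ a b, (if H.Adj a b then 1 else 0) ≤
      if G.Adj a b then 1 else 0 := by
    intro a b
    by_cases h5 : G.Adj a b <;> simp [hadj, h5]
    split_ifs <;> simp
  refine Finset.sum_lt_sum (fun a _ ↦ Finset.sum_le_sum fun b _ ↦ h a b)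
    ⟨u, hu, Finset.sum_lt_sum (fun b _ ↦ h u b) ⟨v, hv, by simp [hadj, huv]⟩⟩

theorem EdgeBound.succ {n : ℕ} (hn : 3 ≤ n) (ih : EdgeBound V n) : EdgeBound V (n + 1) := by
  suffices ∀ m, ∀ G : SimpleGraph V, HT G → ∀ Y : Finset V, Y.card = n + 1 → e G Y Y = m →
      e G Y Y + 12 ≤ 6 * (n + 1) from fun G hG Y hY ↦ this _ G hG Y hY rfl
  intro m
  induction m using Nat.strong_induction_on with
  | _ m ihm =>
  intro G hG Y hY hm
  by_cases hdeg : ∃ v ∈ Y, (nb G Y v).card ≤ 5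
  · obtain ⟨v, hv, h5⟩ := hdeg
    have hvn : v ∉ Y.erase v := Finset.notMem_erase v Y
    have hYv : (Y.erase v).card = n := by rw [Finset.card_erase_of_mem hv, hY]; rfl
    have hnb : nb G (Y.erase v) v = nb G Y v := by
      ext x
      simp only [mem_nb, Finset.mem_erase, and_congr_left_iff, and_iff_right_iff_imp]
      exact fun h _ ↦ h.ne'
    rcases (nb G Y v).eq_empty_or_nonempty with h0 | hne
    · have h1 := e_insert (G := G) hvn
      rw [Finset.insert_erase hv, hnb, h0, Finset.card_empty] at h1
      have := ih G hG _ hYv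
      omega
    · obtain ⟨x, hx, h2⟩ := hG.exists_edge_of_nb_card_le hne h5
      rw [mem_nb] at hx
      have hx' : x ∈ Y.erase v := Finset.mem_erase.2 ⟨hx.2.ne', hx.1⟩
      have hYx : ((Y.erase v).erase x).card = n - 1 := by rw [Finset.card_erase_of_mem hx', hYv]
      have ih' : EdgeBound V (n - 1 + 1) := by rwa [Nat.sub_add_cancel (by omega)]
      have h3 := ih'.edge hG (Y := (Y.erase v).erase x) hx.2 (by simp) (by simp) hYx
      rw [Finset.insert_erase hx', Finset.insert_erase hv] at h3
      have h4 : (nb G (nb G ((Y.erase v).erase x) v) x).card ≤ (nb G (nb G Y v) x).card :=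
        Finset.card_le_card fun y hy ↦ by
          simp only [mem_nb, Finset.mem_erase] at hy ⊢
          exact ⟨⟨hy.1.1.2.2, hy.1.2⟩, hy.2⟩
      omega
  · push Not at hdeg
    have h6 : 6 * (n + 1) ≤ e G Y Y := by
      rw [e_eq_sum_card, ← hY, mul_comm, ← smul_eq_mul]
      exact Finset.card_nsmul_le_sum _ _ _ fun v hv ↦ hdeg v hv
    obtain ⟨v, hv⟩ : Y.Nonempty := by rw [← Finset.card_pos]; omega
    obtain ⟨x, hx⟩ : (nb G Y v).Nonempty := by
      rw [← Finset.card_pos]; have := hdeg v hv; omega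
    rw [mem_nb] at hx
    have h1 := e_deleteEdges_lt hx.2 hv hx.1
    have h2 := e_deleteEdges (G := G) (u := v) (v := x) Y
    have := ihm _ (hm ▸ h1) _ (hG.mono (G.deleteEdges_le _)) Y hY rfl
    omega

theorem edgeBound (n : ℕ) (hn : 3 ≤ n) : EdgeBound V n := by
  induction n, hn using Nat.le_induction with
  | base =>
    intro G _ Y hY
    have := e_self_le (G := G) Y
    rw [hY] at this
    omega
  | succ n hn ih => exact ih.succ hn

theorem HT.edge_bound (hG : HT G) {Y : Finset V} (hY : 3 ≤ Y.card) :
    e G Y Y + 12 ≤ 6 * Y.card := edgeBound _ hY G hG Y rfl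

theorem HT.hub_bound (hG : HT G) {X : Set V} (hX : Conn G X) (hX' : X.Nonempty) {Y T : Finset V}
    (hY : ∀ y ∈ Y, y ∉ X) (hn : 2 ≤ Y.card) (hT : T ⊆ Y) (hTX : ∀ y ∈ T, ∃ x ∈ X, G.Adj x y) :
    e G Y Y + 2 * T.card + 6 ≤ 6 * Y.card := by
  have h1 := (edgeBound _ (by omega)).hub hG hX hX' hY rfl
  have h2 : T.card ≤ (Y.filter fun y ↦ ∃ x ∈ X, G.Adj x y).card :=
    Finset.card_le_card fun y hy ↦ Finset.mem_filter.2 ⟨hT hy, hTX y hy⟩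
  omega

theorem HT.edge_bound_common (hG : HT G) {Y : Finset V} (hY : 2 ≤ Y.card) {u v : V}
    (huv : G.Adj u v) (hu : u ∉ Y) (hv : v ∉ Y) :
    e G (insert u (insert v Y)) (insert u (insert v Y)) + 4 ≤
      6 * Y.card + 2 * (nb G (nb G Y u) v).card :=
  (edgeBound _ (by omega)).edge hG huv hu hv rfl

end EdgeBound

end PlanarSeq

namespace PlanarSeq

open scoped Classical

variable {V : Type*} {G : SimpleGraph V}

section SmallSide

theorem comp_eq_of_mem {X : Set V} {a b : V} (h : b ∈ comp G X a) : comp G X b = comp G X a := by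
  have hsymm : Std.Symm fun x y ↦ G.Adj x y ∧ x ∈ X ∧ y ∈ X :=
    ⟨fun x y h ↦ ⟨h.1.symm, h.2.2, h.2.1⟩⟩
  have h' : a ∈ comp G X b := Relation.ReflTransGen.stdSymm.symm _ _ h
  exact Set.ext fun c ↦ ⟨fun hc ↦ Relation.ReflTransGen.trans h hc,
    fun hc ↦ Relation.ReflTransGen.trans h' hc⟩

theorem small_side_arith {k r E₁ M E₂ C : ℕ} (h1 : 1 ≤ k + r) (h8 : k + r ≤ 8)
    (hE₁ : E₁ ≤ k * (k - 1)) (hE₂ : E₂ ≤ r * (r - 1)) (hM : M ≤ k * r) (hC : C ≤ k * 3)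
    (hd₁ : k * 5 ≤ E₁ + M + C) (hd₂ : r * 5 ≤ M + E₂)
    (hb₁ : 3 ≤ k → E₁ + 12 ≤ 6 * k) (hb₂ : 3 ≤ r → E₂ + 12 ≤ 6 * r)
    (hbS : E₁ + 2 * M + E₂ + 2 * C ≤ 6 * (k + r))
    (hS : 2 ≤ k + r → E₁ + 2 * M + E₂ + 2 * k + 6 ≤ 6 * (k + r))
    (hSx : 3 ≤ k + r → k * (E₁ + 2 * M + E₂ + 2 * k + 10) ≤ k * (6 * (k + r)) + 2 * E₁)
    (hSA : 1 ≤ k → 2 ≤ r → r ≤ 5 → E₂ + 2 * r + 6 ≤ 6 * r)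
    (hSA' : 1 ≤ k → 2 ≤ r → E₂ + 6 ≤ 6 * r) : False := by
  have hk : k ≤ 8 := by omega
  have hr : r ≤ 8 := by omega
  interval_cases k <;> interval_cases r <;> omega

theorem card_nb_self_lt (A : Finset V) {a : V} (ha : a ∈ A) : (nb G A a).card < A.card :=
  Finset.card_lt_card ⟨fun _ hx ↦ (mem_nb.1 hx).1,
    fun h ↦ (mem_nb.1 (h ha)).2.ne rfl⟩

theorem nb_union_card {A B : Finset V} (h : Disjoint A B) (a : V) :
    (nb G (A ∪ B) a).card = (nb G A a).card + (nb G B a).card := by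
  rw [nb, Finset.filter_union, Finset.card_union_of_disjoint]
  · rfl
  · exact Finset.disjoint_filter_filter h

theorem e_le_mul (A B : Finset V) : e G A B ≤ A.card * B.card := by
  rw [e_eq_sum_card]
  exact Finset.sum_le_card_nsmul _ _ _ fun a _ ↦ Finset.card_filter_le _ _

variable [Fintype V]

/-- Each side of a separating triangle has at least nine vertices if its vertices have degree at
least five. -/
theorem HT.false_of_small_side (hG : HT G) {s₁ s₂ s₃ : V} (h12 : G.Adj s₁ s₂) (h13 : G.Adj s₁ s₃)
    (h23 : G.Adj s₂ s₃) {A : Finset V} (hA : A.Nonempty) (h8 : A.card ≤ 8)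
    (hdisj : Disjoint A {s₁, s₂, s₃})
    (hclosed : ∀ a ∈ A, ∀ b, G.Adj a b → b ∈ A ∪ {s₁, s₂, s₃})
    (hdeg : ∀ a ∈ A, 5 ≤ (nb G Finset.univ a).card) : False := by
  obtain ⟨S, hS⟩ : ∃ S : Finset V, S = {s₁, s₂, s₃} := ⟨_, rfl⟩
  rw [← hS] at hdisj hclosed
  have hS3 : S.card = 3 := by
    rw [hS]; exact Finset.card_eq_three.2 ⟨_, _, _, h12.ne, h13.ne, h23.ne, rfl⟩
  have hSS : e G S S = 6 := by
    rw [hS, e_insert (by simp [h12.ne, h13.ne]), e_insert (by simp [h23.ne]), e_singleton_left,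
      nb_singleton_self]
    simp [nb, Finset.filter_insert, Finset.filter_singleton, h12, h13, h23, h23.ne]
  have hSconn : Conn G (S : Set V) := by
    have := (((conn_singleton s₃).insert rfl h23).insert (by simp) h12 : Conn G _)
    simpa [hS] using this
  have hSne : (S : Set V).Nonempty := ⟨s₁, by simp [hS]⟩
  obtain ⟨A₁, hA₁⟩ : ∃ A₁ : Finset V, A₁ = A.filter fun a ↦ ∃ s ∈ S, G.Adj s a := ⟨_, rfl⟩
  obtain ⟨A₂, hA₂⟩ : ∃ A₂ : Finset V, A₂ = A.filter fun a ↦ ¬ ∃ s ∈ S, G.Adj s a := ⟨_, rfl⟩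
  have hd : Disjoint A₁ A₂ := by rw [hA₁, hA₂]; exact Finset.disjoint_filter_filter_not _ _ _
  have hu : A₁ ∪ A₂ = A := by rw [hA₁, hA₂]; exact Finset.filter_union_filter_not_eq _ _
  have hcard : A₁.card + A₂.card = A.card := by rw [← hu, Finset.card_union_of_disjoint hd]
  have m1 : ∀ a ∈ A₁, a ∈ A := fun a ha ↦ hu ▸ Finset.mem_union_left _ ha
  have m2 : ∀ a ∈ A₂, a ∈ A := fun a ha ↦ hu ▸ Finset.mem_union_right _ ha
  have hAS : ∀ a ∈ A, a ∉ S := fun a ha hs ↦ Finset.disjoint_left.1 hdisj ha hs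
  have hS2 : ∀ a ∈ A₂, (nb G S a).card = 0 := by
    intro a ha
    rw [hA₂, Finset.mem_filter] at ha
    rw [Finset.card_eq_zero, Finset.eq_empty_iff_forall_notMem]
    intro s hs
    rw [mem_nb] at hs
    exact ha.2 ⟨s, hs.1, hs.2.symm⟩
  have hdeg' : ∀ a ∈ A, 5 ≤ (nb G A₁ a).card + (nb G A₂ a).card + (nb G S a).card := by
    intro a ha
    rw [← nb_union_card hd, hu, ← nb_union_card hdisj]
    refine (hdeg a ha).trans (Finset.card_le_card fun x hx ↦ ?_)
    rw [mem_nb] at hx ⊢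
    exact ⟨hclosed a ha x hx.2, hx.2⟩
  have hAA : e G A A = e G A₁ A₁ + 2 * e G A₁ A₂ + e G A₂ A₂ := by rw [← hu, e_union hd]
  have hAS' : e G A S = e G A₁ S := by
    rw [← hu, e_union_left hd, e_eq_sum_card A₂, Finset.sum_eq_zero hS2, add_zero]
  refine small_side_arith (k := A₁.card) (r := A₂.card) (E₁ := e G A₁ A₁) (M := e G A₁ A₂)
    (E₂ := e G A₂ A₂) (C := e G A₁ S) ?_ ?_ ?_ ?_ ?_ ?_ ?_ ?_ ?_ ?_ ?_ ?_ ?_ ?_ ?_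
  · rw [hcard]; exact hA.card_pos
  · rwa [hcard]
  · exact e_self_le _
  · exact e_self_le _
  · exact e_le_mul _ _
  · exact hS3 ▸ e_le_mul _ _
  · simp only [e_eq_sum_card, ← Finset.sum_add_distrib]
    rw [← smul_eq_mul]
    exact Finset.card_nsmul_le_sum A₁ _ 5 fun a ha ↦ hdeg' a (m1 a ha)
  · rw [e_comm]
    simp only [e_eq_sum_card, ← Finset.sum_add_distrib]
    rw [← smul_eq_mul]
    refine Finset.card_nsmul_le_sum A₂ _ 5 fun a ha ↦ ?_
    have := hdeg' a (m2 a ha)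
    rwa [hS2 a ha, add_zero] at this
  · exact fun h ↦ hG.edge_bound h
  · exact fun h ↦ hG.edge_bound h
  · have := hG.edge_bound (Y := A ∪ S)
      (hS3 ▸ Finset.card_le_card Finset.subset_union_right)
    rw [Finset.card_union_of_disjoint hdisj, e_union hdisj, hSS, hS3, hAA, hAS'] at this
    omega
  · intro h
    have := hG.hub_bound hSconn hSne (Y := A) (T := A₁) (fun y hy ↦ by simpa using hAS y hy)
      (hcard ▸ h) m1 fun y hy ↦ by rw [hA₁, Finset.mem_filter] at hy; exact hy.2
    rw [hAA] at this
    omega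
  · intro h
    have key : ∀ x ∈ A₁, e G A A + 2 * A₁.card + 10 ≤ 6 * A.card + 2 * (nb G A₁ x).card := by
      intro x hx
      have hxA := m1 x hx
      have hx' : ∃ s ∈ S, G.Adj s x := by rw [hA₁, Finset.mem_filter] at hx; exact hx.2
      obtain ⟨s, hs, hsx⟩ := hx'
      have hX : Conn G (insert x (S : Set V)) := hSconn.insert (by simpa using hs) hsx.symm
      have hY : (A.erase x).card = A.card - 1 := Finset.card_erase_of_mem hxA
      have h2 := e_insert (G := G) (Finset.notMem_erase x A)
      rw [Finset.insert_erase hxA] at h2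
      have h3 : nb G (A.erase x) x = nb G A x := by
        ext y
        simp only [mem_nb, Finset.mem_erase, and_congr_left_iff, and_iff_right_iff_imp]
        exact fun h _ ↦ h.ne'
      have h4 := hG.hub_bound hX (Set.insert_nonempty _ _) (Y := A.erase x)
        (T := A₁.erase x ∪ nb G A₂ x)
        (by
          intro y hy
          rw [Finset.mem_erase] at hy
          simp [hy.1, hAS y hy.2])
        (by omega)
        (by
          intro y hy
          rw [Finset.mem_union, Finset.mem_erase, mem_nb] at hy
          rw [Finset.mem_erase]
          rcases hy with ⟨hy, hy1⟩ | ⟨hy, hxy⟩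
          exacts [⟨hy, m1 y hy1⟩, ⟨hxy.ne', m2 y hy⟩])
        (by
          intro y hy
          rw [Finset.mem_union, Finset.mem_erase, mem_nb] at hy
          rcases hy with ⟨hy, hy1⟩ | ⟨hy, hxy⟩
          · rw [hA₁, Finset.mem_filter] at hy1
            obtain ⟨s, hs, h⟩ := hy1.2
            exact ⟨s, by simp [hs], h⟩
          · exact ⟨x, by simp, hxy⟩)
      rw [Finset.card_union_of_disjoint, Finset.card_erase_of_mem hx] at h4
      · have h5 := nb_union_card (G := G) hd x
        rw [hu] at h5
        rw [h3] at h2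
        have := Finset.card_pos.2 ⟨x, hx⟩
        omega
      · refine Finset.disjoint_left.2 fun y hy hy' ↦ ?_
        exact Finset.disjoint_left.1 hd (Finset.mem_of_mem_erase hy) (mem_nb.1 hy').1
    have := Finset.sum_le_sum key
    simp only [Finset.sum_const, Finset.sum_add_distrib, ← Finset.mul_sum, smul_eq_mul,
      ← e_eq_sum_card] at this
    rw [hcard, ← hAA]
    linarith
  all_goals
    intro hk hr
    have hX : Conn G ((S : Set V) ∪ A₁) := by
      have : ∀ T : Finset V, T ⊆ A₁ → Conn G ((S : Set V) ∪ T) := by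
        intro T
        induction T using Finset.induction_on with
        | empty => simpa using hSconn
        | insert x T _ ih =>
          intro hT
          have hx := hT (Finset.mem_insert_self x T)
          rw [hA₁, Finset.mem_filter] at hx
          obtain ⟨s, hs, h⟩ := hx.2
          rw [Finset.coe_insert, Set.union_insert]
          exact (ih ((Finset.subset_insert _ _).trans hT)).insert (.inl hs) h.symm
      exact this _ subset_rfl
    have h1 := fun T ↦ hG.hub_bound hX (hSne.mono Set.subset_union_left) (Y := A₂) (T := T)
      (by
        intro y hy
        have := Finset.disjoint_right.1 hd hy
        simp [hAS y (m2 y hy), this]) hr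
  · intro hr5
    refine h1 A₂ subset_rfl fun y hy ↦ ?_
    have h2 := hdeg' y (m2 y hy)
    have h3 := card_nb_self_lt (G := G) A₂ hy
    rw [hS2 y hy] at h2
    have : 0 < (nb G A₁ y).card := by omega
    obtain ⟨x, hx⟩ := Finset.card_pos.1 this
    rw [mem_nb] at hx
    exact ⟨x, .inr hx.1, hx.2.symm⟩
  · simpa using h1 ∅ (by simp) (by simp)

/-- Triangles do not separate a planar graph with minimum degree five on at most 20 vertices. -/
theorem HT.mem_comp_compl_triangle (hG : HT G) (hV : Fintype.card V ≤ 20)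
    (hdeg : ∀ a, 5 ≤ (nb G Finset.univ a).card) {a b c : V} (hab : G.Adj a b) (hac : G.Adj a c)
    (hbc : G.Adj b c) {y z : V} (hy : y ∉ ({a, b, c} : Set V)) (hz : z ∉ ({a, b, c} : Set V)) :
    z ∈ comp G ({a, b, c} : Set V)ᶜ y := by
  by_contra hcon
  have hX : ∀ y ∉ ({a, b, c} : Set V), 9 ≤ (comp G ({a, b, c} : Set V)ᶜ y).toFinset.card := by
    intro y hy
    by_contra! h
    have hsub := comp_subset (G := G) (X := ({a, b, c} : Set V)ᶜ) hy
    refine hG.false_of_small_side hab hac hbc (A := (comp G ({a, b, c} : Set V)ᶜ y).toFinset)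
      ⟨y, by simpa using self_mem_comp _ _⟩ (by omega) ?_ ?_ fun a _ ↦ hdeg a
    · refine Finset.disjoint_left.2 fun x hx hx' ↦ ?_
      rw [Set.mem_toFinset] at hx
      exact hsub hx (by simpa using hx')
    · intro x hx w hxw
      rw [Set.mem_toFinset] at hx
      rw [Finset.mem_union, Set.mem_toFinset]
      by_cases hw : w ∈ ({a, b, c} : Set V)
      · exact .inr (by simpa using hw)
      · exact .inl (mem_comp_of_adj hy hx hxw hw)
  have h1 := hX y hy
  have h2 := hX z hz
  have hd : Disjoint (comp G ({a, b, c} : Set V)ᶜ y).toFinset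
      (comp G ({a, b, c} : Set V)ᶜ z).toFinset := by
    refine Finset.disjoint_left.2 fun x hx hx' ↦ hcon ?_
    rw [Set.mem_toFinset] at hx hx'
    rw [← comp_eq_of_mem hx, comp_eq_of_mem hx']
    exact self_mem_comp _ _
  have hd' : Disjoint ((comp G ({a, b, c} : Set V)ᶜ y).toFinset ∪
      (comp G ({a, b, c} : Set V)ᶜ z).toFinset) {a, b, c} := by
    refine Finset.disjoint_left.2 fun x hx hx' ↦ ?_
    rw [Finset.mem_union, Set.mem_toFinset, Set.mem_toFinset] at hx
    have : x ∈ ({a, b, c} : Set V) := by simpa using hx'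
    exact hx.elim (fun h ↦ comp_subset hy h this) (fun h ↦ comp_subset hz h this)
  have h3 := Finset.card_le_univ ((comp G ({a, b, c} : Set V)ᶜ y).toFinset ∪
      (comp G ({a, b, c} : Set V)ᶜ z).toFinset ∪ {a, b, c})
  rw [Finset.card_union_of_disjoint hd', Finset.card_union_of_disjoint hd,
    Finset.card_eq_three.2 ⟨_, _, _, hab.ne, hac.ne, hbc.ne, rfl⟩] at h3
  omega

end SmallSide

end PlanarSeq

namespace PlanarSeq

open scoped Classical

variable {V : Type*} {G : SimpleGraph V}

section Minors

/-- Some edge joins `A` to `B`. -/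
def Touch (G : SimpleGraph V) (A B : Set V) : Prop := ∃ a ∈ A, ∃ b ∈ B, G.Adj a b

theorem Touch.symm {A B : Set V} (h : Touch G A B) : Touch G B A := by
  obtain ⟨a, ha, b, hb, h⟩ := h
  exact ⟨b, hb, a, ha, h.symm⟩

theorem HT.false_of_K33_sets (hG : HT G) {A₁ A₂ A₃ B₁ B₂ B₃ : Set V}
    (hconn : ∀ X ∈ [A₁, A₂, A₃, B₁, B₂, B₃], Conn G X)
    (hdisj : [A₁, A₂, A₃, B₁, B₂, B₃].Pairwise Disjoint)
    (hadj : ∀ X ∈ [A₁, A₂, A₃], ∀ Y ∈ [B₁, B₂, B₃], Touch G X Y) : False := by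
  refine hG.false_of_K33 [A₁, A₂, A₃, B₁, B₂, B₃].get (fun w ↦ hconn _ (List.get_mem _ _)) ?_ ?_
  · intro w w' z h hz
    exact Set.disjoint_left.1 (List.pairwise_iff_get.1 hdisj w w' h) hz
  · intro w w' h h'
    have h1 : ∀ w : Fin 6, w < 3 → [A₁, A₂, A₃, B₁, B₂, B₃].get w ∈ [A₁, A₂, A₃] := by
      intro w
      fin_cases w <;> simp
    have h2 : ∀ w : Fin 6, 3 ≤ w → [A₁, A₂, A₃, B₁, B₂, B₃].get w ∈ [B₁, B₂, B₃] := by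
      intro w
      fin_cases w <;> simp
    exact hadj _ (h1 w h) _ (h2 w' h')

theorem HT.false_of_K5_sets (hG : HT G) {A₁ A₂ A₃ A₄ A₅ : Set V}
    (hconn : ∀ X ∈ [A₁, A₂, A₃, A₄, A₅], Conn G X)
    (hdisj : [A₁, A₂, A₃, A₄, A₅].Pairwise Disjoint)
    (hadj : [A₁, A₂, A₃, A₄, A₅].Pairwise (Touch G)) : False := by
  refine hG.false_of_K5 [A₁, A₂, A₃, A₄, A₅].get (fun w ↦ hconn _ (List.get_mem _ _)) ?_ ?_
  · intro w w' z h hz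
    exact Set.disjoint_left.1 (List.pairwise_iff_get.1 hdisj w w' h) hz
  · intro w w' h
    exact List.pairwise_iff_get.1 hadj w w' h

end Minors

section CommonNeighbours

theorem conn_empty : Conn G ∅ := by
  rintro P ⟨a, ha, -⟩
  exact ha.elim

/-- If deleting the triangle `p q r` does not disconnect the graph, two further vertices `x` and
`y` are adjacent or joined through a component `M` of the rest. -/
theorem exists_link {T Z : Set V} (hT : ∀ y ∉ T, ∀ z ∉ T, z ∈ comp G Tᶜ y) {x y : V} (hx : x ∉ T)
    (hy : y ∉ T) (hxy : x ≠ y) (hZ : ∀ z, z ∈ Z ↔ z ∉ T ∧ z ≠ x ∧ z ≠ y) :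
    ∃ M ⊆ Z, (∀ m ∈ M, comp G Z m = M) ∧ Conn G M ∧
      (M = ∅ ∧ Touch G {x} {y} ∨ Touch G {x} M ∧ Touch G M {y}) := by
  by_cases hadj : G.Adj x y
  · exact ⟨∅, by simp, by simp, conn_empty, .inl ⟨rfl, x, rfl, y, rfl, hadj⟩⟩
  by_contra hcon
  have key : ∀ z ∈ comp G Tᶜ x, z = x ∨ ∃ m ∈ Z, z ∈ comp G Z m ∧ Touch G {x} (comp G Z m) := by
    intro z hz
    induction hz with
    | refl => exact .inl rfl
    | @tail z w _ h ih =>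
      obtain ⟨hzw, hz, hw⟩ := h
      by_cases hwx : w = x
      · exact .inl hwx
      right
      rcases ih with rfl | ⟨m, hm, hzm, ht⟩
      · have hwZ : w ∈ Z := (hZ w).2 ⟨hw, hwx, fun h ↦ hadj (h ▸ hzw)⟩
        exact ⟨w, hwZ, self_mem_comp _ _, z, rfl, w, self_mem_comp _ _, hzw⟩
      · by_cases hwy : w = y
        · refine (hcon ⟨comp G Z m, comp_subset hm, fun a ha ↦ comp_eq_of_mem ha, conn_comp m,
            .inr ⟨ht, z, hzm, w, hwy, hzw⟩⟩).elim
        · exact ⟨m, hm, mem_comp_of_adj hm hzm hzw ((hZ w).2 ⟨hw, hwx, hwy⟩), ht⟩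
  rcases key y (hT x hx y hy) with h | ⟨m, hm, h, -⟩
  · exact hxy h.symm
  · exact ((hZ y).1 (comp_subset hm h)).2.2 rfl

theorem HT.false_of_three_common (hG : HT G) {u v : V} {x : Fin 3 → V} (huv : G.Adj u v)
    (hux : ∀ i, G.Adj u (x i)) (hvx : ∀ i, G.Adj v (x i)) (hx : Function.Injective x)
    (hsep : ∀ a b c, G.Adj a b → G.Adj a c → G.Adj b c → ∀ y ∉ ({a, b, c} : Set V),
      ∀ z ∉ ({a, b, c} : Set V), z ∈ comp G ({a, b, c} : Set V)ᶜ y) : False := by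
  obtain ⟨Z, hZ⟩ : ∃ Z : Set V, ∀ z, z ∈ Z ↔ z ≠ u ∧ z ≠ v ∧ ∀ i, z ≠ x i :=
    ⟨{z | z ≠ u ∧ z ≠ v ∧ ∀ i, z ≠ x i}, fun z ↦ Iff.rfl⟩
  have hlink : ∀ i : Fin 3, ∃ M ⊆ Z, (∀ m ∈ M, comp G Z m = M) ∧ Conn G M ∧
      (M = ∅ ∧ Touch G {x i} {x (i + 1)} ∨ Touch G {x i} M ∧ Touch G M {x (i + 1)}) := by
    intro i
    have h1 : i ≠ i + 2 := by revert i; decide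
    have h2 : i + 1 ≠ i + 2 := by revert i; decide
    have h3 : i ≠ i + 1 := by revert i; decide
    have h4 : ∀ j : Fin 3, j = i ∨ j = i + 1 ∨ j = i + 2 := by revert i; decide
    refine exists_link (hsep u v (x (i + 2)) huv (hux _) (hvx _)) ?_ ?_ (hx.ne h3) fun z ↦ ?_
    · simp [(hux i).ne', (hvx i).ne', hx.ne h1]
    · simp [(hux (i + 1)).ne', (hvx (i + 1)).ne', hx.ne h2]
    · rw [hZ]
      simp only [Set.mem_insert_iff, Set.mem_singleton_iff, not_or]
      constructor
      · exact fun h ↦ ⟨⟨h.1, h.2.1, h.2.2 _⟩, h.2.2 _, h.2.2 _⟩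
      · rintro ⟨⟨h1, h2, h3⟩, h5, h6⟩
        refine ⟨h1, h2, fun j ↦ ?_⟩
        rcases h4 j with rfl | rfl | rfl
        exacts [h5, h6, h3]
  choose M hMZ hM hMconn hMadj using hlink
  have hu : ∀ i, u ∉ M i := fun i h ↦ ((hZ u).1 (hMZ i h)).1 rfl
  have hv : ∀ i, v ∉ M i := fun i h ↦ ((hZ v).1 (hMZ i h)).2.1 rfl
  have hxM : ∀ i j, x j ∉ M i := fun i j h ↦ ((hZ (x j)).1 (hMZ i h)).2.2 j rfl
  have n01 := hx.ne (show (0 : Fin 3) ≠ 1 by decide)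
  have n02 := hx.ne (show (0 : Fin 3) ≠ 2 by decide)
  have n12 := hx.ne (show (1 : Fin 3) ≠ 2 by decide)
  have tu : ∀ i, Touch G {u} {x i} := fun i ↦ ⟨u, rfl, x i, rfl, hux i⟩
  have tv : ∀ i, Touch G {v} {x i} := fun i ↦ ⟨v, rfl, x i, rfl, hvx i⟩
  have K33 : ∀ M : Set V, Conn G M → M ⊆ Z → (∀ i, Touch G M {x i}) → False := by
    intro M hM hMZ hMx
    have hu : u ∉ M := fun h ↦ ((hZ u).1 (hMZ h)).1 rfl
    have hv : v ∉ M := fun h ↦ ((hZ v).1 (hMZ h)).2.1 rfl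
    have hxM : ∀ j, x j ∉ M := fun j h ↦ ((hZ (x j)).1 (hMZ h)).2.2 j rfl
    refine hG.false_of_K33_sets (A₁ := {u}) (A₂ := {v}) (A₃ := M) (B₁ := {x 0}) (B₂ := {x 1})
      (B₃ := {x 2}) ?_ ?_ ?_
    · simp [conn_singleton, hM]
    · simp [huv.ne, (hux _).ne, (hvx _).ne, hu, hv, hxM, n01, n02, n12]
    · simp [tu, tv, hMx]
  have hdisj : ∀ i, Disjoint (M i) (M (i + 1)) := by
    intro i
    rw [Set.disjoint_left]
    intro z hz hz'
    have heq : M (i + 1) = M i := (hM _ z hz').symm.trans (hM _ z hz)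
    have h1 : ∀ j, (M j).Nonempty → Touch G {x j} (M j) ∧ Touch G (M j) {x (j + 1)} :=
      fun j hj ↦ (hMadj j).resolve_left fun h ↦ hj.ne_empty h.1
    have h2 := h1 i ⟨z, hz⟩
    have h3 := h1 (i + 1) ⟨z, hz'⟩
    rw [heq] at h3
    refine K33 (M i) (hMconn i) (hMZ i) fun j ↦ ?_
    have h4 : ∀ i j : Fin 3, j = i ∨ j = i + 1 ∨ j = i + 1 + 1 := by decide
    rcases h4 i j with rfl | rfl | rfl
    exacts [h2.1.symm, h2.2, h3.2]
  have hW : ∀ i, Conn G (insert (x i) (M i)) := by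
    intro i
    rcases hMadj i with ⟨h, -⟩ | ⟨⟨_, rfl, b, hb, h⟩, -⟩
    · rw [h, insert_empty_eq]
      exact conn_singleton _
    · exact (hMconn i).insert hb h
  have tW : ∀ i, Touch G (insert (x i) (M i)) (insert (x (i + 1)) (M (i + 1))) := by
    intro i
    rcases hMadj i with ⟨-, _, rfl, _, rfl, h⟩ | ⟨-, a, ha, _, rfl, h⟩
    · exact ⟨_, .inl rfl, _, .inl rfl, h⟩
    · exact ⟨a, .inr ha, _, .inl rfl, h⟩
  have tuW : ∀ i, Touch G {u} (insert (x i) (M i)) := fun i ↦ ⟨u, rfl, x i, .inl rfl, hux i⟩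
  have tvW : ∀ i, Touch G {v} (insert (x i) (M i)) := fun i ↦ ⟨v, rfl, x i, .inl rfl, hvx i⟩
  have tuv : Touch G {u} {v} := ⟨u, rfl, v, rfl, huv⟩
  have t02 := (tW 2).symm
  refine hG.false_of_K5_sets (A₁ := {u}) (A₂ := {v}) (A₃ := insert (x 0) (M 0))
    (A₄ := insert (x 1) (M 1)) (A₅ := insert (x 2) (M 2)) ?_ ?_ ?_
  · simp [conn_singleton, hW]
  · simp [huv.ne, (hux _).ne, (hvx _).ne, hu, hv, hxM, n01, n02, n12]
    exact ⟨⟨hdisj 0, (hdisj 2).symm⟩, hdisj 1⟩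
  · simp only [List.pairwise_cons, List.mem_cons, List.not_mem_nil, or_false, forall_eq_or_imp,
      forall_eq, List.Pairwise.nil, and_true, IsEmpty.forall_iff, implies_true]
    exact ⟨⟨tuv, tuW 0, tuW 1, tuW 2⟩, ⟨tvW 0, tvW 1, tvW 2⟩, ⟨tW 0, t02⟩, tW 1⟩

end CommonNeighbours

section UniqueCommonNeighbour

variable [Fintype V]

/-- The number of ordered triangles is divisible by three. -/
theorem three_dvd_triangles :
    3 ∣ ∑ u, ∑ v, if G.Adj u v then (nb G (nb G Finset.univ u) v).card else 0 := by
  let T := {t : V × V × V // G.Adj t.1 t.2.1 ∧ G.Adj t.2.1 t.2.2 ∧ G.Adj t.2.2 t.1}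
  let f : Function.End T := fun t ↦ ⟨(t.1.2.1, t.1.2.2, t.1.1), t.2.2.1, t.2.2.2, t.2.1⟩
  have hf : f ^ 3 ^ 1 = 1 := rfl
  have hfix : Function.fixedPoints f = ∅ := by
    rw [Set.eq_empty_iff_forall_notMem]
    rintro ⟨⟨u, v, w⟩, h1, h2, h3⟩ h
    have : v = u := congrArg (fun t : T ↦ t.1.1) h
    exact h1.ne this.symm
  have : Fact (Nat.Prime 3) := ⟨Nat.prime_three⟩
  have hmod := Equiv.Perm.card_fixedPoints_modEq hf
  have h0 : Fintype.card (Function.fixedPoints f) = 0 := by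
    rw [Fintype.card_eq_zero_iff, Set.isEmpty_coe_sort]
    exact hfix
  rw [h0] at hmod
  have hcard : Fintype.card T =
      ∑ u, ∑ v, if G.Adj u v then (nb G (nb G Finset.univ u) v).card else 0 := by
    rw [Fintype.card_subtype, Finset.card_filter]
    simp only [Fintype.sum_prod_type]
    refine Finset.sum_congr rfl fun u _ ↦ Finset.sum_congr rfl fun v _ ↦ ?_
    split_ifs with h
    · rw [Finset.card_eq_sum_ones, nb, nb, Finset.sum_filter, Finset.sum_filter]
      refine Finset.sum_congr rfl fun w _ ↦ ?_
      simp only [h, true_and, G.adj_comm w u]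
      split_ifs <;> simp_all
    · simp [h]
  rw [← hcard]
  exact (Nat.modEq_zero_iff_dvd).1 hmod

theorem HT.exists_unique_common (hG : HT G) (hV : Fintype.card V = 20)
    (hdeg : ∀ a, 5 ≤ (nb G Finset.univ a).card) (he : e G Finset.univ Finset.univ = 106) :
    ∃ u v x, G.Adj u v ∧ ∀ y, G.Adj u y ∧ G.Adj v y ↔ y = x := by
  have hle : ∀ u v, G.Adj u v → (nb G (nb G Finset.univ u) v).card ≤ 2 := by
    intro u v huv
    by_contra! h
    obtain ⟨s, hs, hs3⟩ := Finset.exists_subset_card_eq h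
    let f := (Fintype.equivFinOfCardEq (α := s) (by simpa using hs3)).symm
    have hf : ∀ i, G.Adj u (f i) ∧ G.Adj v (f i) := by
      intro i
      have := hs (f i).2
      simpa using this
    exact hG.false_of_three_common huv (fun i ↦ (hf i).1) (fun i ↦ (hf i).2)
      (Subtype.val_injective.comp f.injective) fun a b c hab hac hbc y hy z hz ↦
        hG.mem_comp_compl_triangle hV.le hdeg hab hac hbc hy hz
  have hge : ∀ u v, G.Adj u v → 1 ≤ (nb G (nb G Finset.univ u) v).card := by
    intro u v huv
    have hins : insert u (insert v ((Finset.univ.erase u).erase v)) = Finset.univ := by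
      ext z
      by_cases h1 : z = u <;> by_cases h2 : z = v <;> simp [h1, h2]
    have hc : ((Finset.univ.erase u).erase v).card = 18 := by
      rw [Finset.card_erase_of_mem (by simp [huv.ne']), Finset.card_erase_of_mem (by simp),
        Finset.card_univ, hV]
    have h1 := hG.edge_bound_common (Y := (Finset.univ.erase u).erase v) (by omega) huv (by simp)
      (by simp)
    rw [hins, he, hc] at h1
    have h2 : (nb G (nb G ((Finset.univ.erase u).erase v) u) v).card ≤
        (nb G (nb G Finset.univ u) v).card := by
      refine Finset.card_le_card fun z ↦ ?_
      simp only [mem_nb]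
      exact fun h ↦ ⟨⟨Finset.mem_univ _, h.1.2⟩, h.2⟩
    omega
  by_contra! hcon
  have htwo : ∀ u v, G.Adj u v → (nb G (nb G Finset.univ u) v).card = 2 := by
    intro u v huv
    have h1 := hle u v huv
    have h2 := hge u v huv
    by_contra h3
    obtain ⟨x, hx⟩ := Finset.card_eq_one.1 (show (nb G (nb G Finset.univ u) v).card = 1 by omega)
    obtain ⟨y, hy⟩ := hcon u v x huv
    have := Finset.ext_iff.1 hx y
    simp only [mem_nb, Finset.mem_univ, true_and, Finset.mem_singleton] at this
    tauto
  have h3 := three_dvd_triangles (G := G)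
  have h4 : ∑ u, ∑ v, (if G.Adj u v then (nb G (nb G Finset.univ u) v).card else 0) = 2 * 106 := by
    rw [← he, e, Finset.mul_sum]
    refine Finset.sum_congr rfl fun u _ ↦ ?_
    rw [Finset.mul_sum]
    refine Finset.sum_congr rfl fun v _ ↦ ?_
    split_ifs with h
    · rw [htwo u v h, mul_one]
    · rfl
  omega

end UniqueCommonNeighbour

end PlanarSeq

namespace PlanarSeq

open scoped Classical

variable {V : Type*} {G : SimpleGraph V}

section Arcs

/-- The vertices `L p, …, L (q - 1)`. -/
def arc (L : ℕ → V) (p q : ℕ) : Set V := {z | ∃ i, p ≤ i ∧ i < q ∧ L i = z}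

theorem conn_arc {L : ℕ → V} (hL : ∀ i, G.Adj (L i) (L (i + 1))) (p n : ℕ) :
    Conn G (arc L p (p + (n + 1))) := by
  induction n with
  | zero =>
    have : arc L p (p + (0 + 1)) = {L p} := by
      ext z
      constructor
      · rintro ⟨i, h1, h2, rfl⟩
        rw [show i = p by omega]
        rfl
      · rintro rfl
        exact ⟨p, by omega, by omega, rfl⟩
    rw [this]
    exact conn_singleton _
  | succ n ih =>
    have : arc L p (p + (n + 1 + 1)) = insert (L (p + n + 1)) (arc L p (p + (n + 1))) := by
      ext z
      constructor
      · rintro ⟨i, h1, h2, rfl⟩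
        rcases Nat.lt_or_ge i (p + (n + 1)) with h | h
        · exact .inr ⟨i, h1, h, rfl⟩
        · rw [show i = p + n + 1 by omega]
          exact .inl rfl
      · rintro (rfl | ⟨i, h1, h2, rfl⟩)
        · exact ⟨_, by omega, by omega, rfl⟩
        · exact ⟨i, h1, by omega, rfl⟩
    rw [this]
    exact ih.insert ⟨p + n, by omega, by omega, rfl⟩ (hL _).symm

/-- The neighbours of two adjacent vertices do not interleave on a cycle. -/
theorem HT.false_of_interleaved (hG : HT G) {L : ℕ → V} (hL : ∀ i, G.Adj (L i) (L (i + 1)))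
    {d : ℕ} (hd : L d = L 0) (hinj : ∀ i < d, ∀ j < d, L i = L j → i = j) {s t : V}
    (hs : ∀ i, L i ≠ s) (ht : ∀ i, L i ≠ t) (hst : G.Adj s t) {p q r : ℕ} (hp : 0 < p)
    (hpq : p < q) (hqr : q < r) (hrd : r < d) (h0 : G.Adj s (L 0)) (hq : G.Adj s (L q))
    (h1 : G.Adj t (L p)) (hr : G.Adj t (L r)) : False := by
  have hconn : ∀ p q, p < q → Conn G (arc L p q) := by
    intro p q h
    have := conn_arc hL p (q - p - 1)
    rwa [show p + (q - p - 1 + 1) = q by omega] at this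
  have hdisj : ∀ p q p' q', q ≤ p' → q' ≤ d → Disjoint (arc L p q) (arc L p' q') := by
    intro p q p' q' h1 h2
    rw [Set.disjoint_left]
    rintro z ⟨i, hi, hi', rfl⟩ ⟨j, hj, hj', h⟩
    have := hinj j (by omega) i (by omega) h
    omega
  have hmem : ∀ p q, p < q → L p ∈ arc L p q := fun p q h ↦ ⟨p, le_rfl, h, rfl⟩
  have hnot : ∀ p q, s ∉ arc L p q ∧ t ∉ arc L p q := fun p q ↦
    ⟨fun ⟨i, _, _, h⟩ ↦ hs i h, fun ⟨i, _, _, h⟩ ↦ ht i h⟩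
  have hnext : ∀ p q r, p < q → q < r → Touch G (arc L p q) (arc L q r) := by
    intro p q r h1 h2
    refine ⟨L (q - 1), ⟨q - 1, by omega, by omega, rfl⟩, L q, hmem _ _ h2, ?_⟩
    have := hL (q - 1)
    rwa [show q - 1 + 1 = q by omega] at this
  have hlast : Touch G (arc L 0 p) (arc L r d) := by
    refine ⟨L 0, hmem _ _ hp, L (d - 1), ⟨d - 1, by omega, by omega, rfl⟩, ?_⟩
    have := hL (d - 1)
    rw [show d - 1 + 1 = d by omega, hd] at this
    exact this.symm
  refine hG.false_of_K33_sets (A₁ := arc L 0 p) (A₂ := arc L q r) (A₃ := {t}) (B₁ := arc L p q)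
    (B₂ := arc L r d) (B₃ := {s}) ?_ ?_ ?_
  · simp [conn_singleton, hconn, hp, hpq, hqr, hrd]
  · simp only [List.pairwise_cons, List.mem_cons, List.not_mem_nil, or_false, forall_eq_or_imp,
      forall_eq, List.Pairwise.nil, and_true, IsEmpty.forall_iff, implies_true,
      Set.disjoint_singleton_left, Set.disjoint_singleton_right, hnot, not_false_eq_true, true_and,
      Set.mem_singleton_iff, hst.ne']
    exact ⟨⟨hdisj _ _ _ _ (by omega) (by omega), hdisj _ _ _ _ (by omega) (by omega),
      hdisj _ _ _ _ (by omega) (by omega)⟩, ⟨(hdisj _ _ _ _ (by omega) (by omega)).symm,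
      hdisj _ _ _ _ (by omega) (by omega)⟩, hdisj _ _ _ _ (by omega) (by omega)⟩
  · simp only [List.mem_cons, List.not_mem_nil, or_false, forall_eq_or_imp, forall_eq]
    exact ⟨⟨hnext _ _ _ hp hpq, hlast, L 0, hmem _ _ hp, s, rfl, h0.symm⟩,
      ⟨(hnext _ _ _ hpq hqr).symm, hnext _ _ _ hqr hrd, L q, hmem _ _ hqr, s, rfl, hq.symm⟩,
      ⟨t, rfl, L p, hmem _ _ hpq, h1⟩, ⟨t, rfl, L r, hmem _ _ hrd, hr⟩, t, rfl, s, rfl, hst.symm⟩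

end Arcs

section Rotation

/-- `σ v` permutes the neighbours of `v` cyclically, and `v`, `x`, `σ v x` always bound a triangular
face. -/
structure Tri (G : SimpleGraph V) (σ : V → V → V) : Prop where
  adj : ∀ {v x}, G.Adj v x → G.Adj v (σ v x)
  adj' : ∀ {v x}, G.Adj v x → G.Adj x (σ v x)
  rot : ∀ {v x}, G.Adj v x → σ x (σ v x) = v
  cyc : ∀ v (P : V → Prop), (∃ x, G.Adj v x ∧ P x) → (∀ x, G.Adj v x → P x → P (σ v x)) →
    ∀ x, G.Adj v x → P x

variable {σ : V → V → V}

theorem Tri.rot' (h : Tri G σ) {v x : V} (hvx : G.Adj v x) : σ (σ v x) v = x := by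
  have := h.rot (h.adj' hvx)
  rwa [h.rot hvx] at this

/-- The link of a vertex, traversed from one of its vertices. -/
theorem Tri.exists_period (h : Tri G σ) {u x : V} (hux : G.Adj u x) :
    ∃ d, 0 < d ∧ (σ u)^[d] x = x ∧ (∀ i < d, ∀ j < d, (σ u)^[i] x = (σ u)^[j] x → i = j) ∧
      ∀ z, G.Adj u z → ∃ i < d, (σ u)^[i] x = z := by
  have hex : ∃ d, 0 < d ∧ (σ u)^[d] x = x := by
    refine h.cyc u (fun z ↦ ∃ d, 0 < d ∧ (σ u)^[d] x = z) ⟨_, h.adj hux, 1, one_pos, rfl⟩ ?_ x hux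
    rintro - - ⟨d, hd, rfl⟩
    exact ⟨d + 1, by omega, Function.iterate_succ_apply' _ _ _⟩
  have hd := Nat.find_spec hex
  have hmin := fun m (hm : m < Nat.find hex) ↦ Nat.find_min hex hm
  generalize Nat.find hex = d at hd hmin
  have hlt : ∀ i j, i < j → j < d → (σ u)^[i] x ≠ (σ u)^[j] x := by
    intro i j hij hj heq
    refine hmin (d - j + i) (by omega) ⟨by omega, ?_⟩
    rw [Function.iterate_add_apply, heq, ← Function.iterate_add_apply,
      show d - j + j = d by omega, hd.2]
  refine ⟨d, hd.1, hd.2, fun i hi j hj heq ↦ ?_, fun z hz ↦ ?_⟩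
  · rcases lt_trichotomy i j with hij | hij | hij
    exacts [(hlt i j hij hj heq).elim, hij, (hlt j i hij hi heq.symm).elim]
  · refine h.cyc u (fun z ↦ ∃ i < d, (σ u)^[i] x = z) ⟨x, hux, 0, hd.1, rfl⟩ ?_ z hz
    rintro - - ⟨i, hi, rfl⟩
    rcases Nat.lt_or_ge (i + 1) d with h | h
    · exact ⟨i + 1, h, Function.iterate_succ_apply' _ _ _⟩
    · refine ⟨0, hd.1, ?_⟩
      rw [← Function.iterate_succ_apply' (σ u) i x, show i.succ = d by omega, hd.2]
      rfl

theorem hub_pair_adj_left {u v b : V} (hbu : b ≠ u) (hbv : b ≠ v) :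
    (hub G {u, v} u).Adj u b ↔ G.Adj u b ∨ G.Adj v b := by
  rw [hub_adj_left (by simp) (by simp [hbu, hbv])]
  simp

theorem hub_pair_adj {u v a b : V} (hau : a ≠ u) (hav : a ≠ v) (hbu : b ≠ u) (hbv : b ≠ v) :
    (hub G {u, v} u).Adj a b ↔ G.Adj a b :=
  hub_adj_of_notMem (by simp) (by simp [hau, hav]) (by simp [hbu, hbv])

theorem hub_pair_ne {u v a b : V} (huv : u ≠ v) (h : (hub G {u, v} u).Adj a b) : a ≠ v ∧ b ≠ v := by
  obtain ⟨-, h1, h2, -⟩ := h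
  constructor <;> rintro rfl <;> simp_all

/-- After contracting an edge `u v` with exactly two common neighbours, the link of the new vertex
splits into an arc of neighbours of `v` and an arc of neighbours of `u`. -/
theorem HT.exists_split (hG : HT G) {u v x y : V} (huv : G.Adj u v) (hxy : x ≠ y)
    (hcom : ∀ z, (G.Adj u z ∧ G.Adj v z) ↔ z = x ∨ z = y) (hσ : Tri (hub G {u, v} u) σ) :
    ∃ x y, x ≠ y ∧ (∀ z, (G.Adj u z ∧ G.Adj v z) ↔ z = x ∨ z = y) ∧
      ∃ P : V → Prop, ∀ b, (hub G {u, v} u).Adj u b →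
        (P b ∧ G.Adj v b ∧ G.Adj v (σ u b) ∧ b ≠ y ∧ σ u b ≠ x) ∨
        (¬ P b ∧ G.Adj u b ∧ G.Adj u (σ u b) ∧ b ≠ x ∧ σ u b ≠ y) := by
  have hux := (hcom x).2 (.inl rfl)
  have huy := (hcom y).2 (.inr rfl)
  have hux' : (hub G {u, v} u).Adj u x :=
    (hub_pair_adj_left hux.1.ne' hux.2.ne').2 (.inl hux.1)
  have huy' : (hub G {u, v} u).Adj u y :=
    (hub_pair_adj_left huy.1.ne' huy.2.ne').2 (.inl huy.1)
  obtain ⟨d, hd0, hd, hinj, hcov⟩ := hσ.exists_period hux'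
  obtain ⟨L, hLdef⟩ : ∃ L : ℕ → V, ∀ i, (σ u)^[i] x = L i := ⟨_, fun _ ↦ rfl⟩
  have hL0 : L 0 = x := (hLdef 0).symm
  have hLs : ∀ i, σ u (L i) = L (i + 1) := by
    intro i
    rw [← hLdef, ← hLdef, Function.iterate_succ_apply']
  simp only [hLdef] at hd hinj hcov
  have hLadj : ∀ i, (hub G {u, v} u).Adj u (L i) := by
    intro i
    induction i with
    | zero => rwa [hL0]
    | succ i ih => rw [← hLs]; exact hσ.adj ih
  have hLv : ∀ i, L i ≠ v := fun i ↦ (hub_pair_ne huv.ne (hLadj i)).2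
  have hLu : ∀ i, L i ≠ u := fun i ↦ (hLadj i).ne'
  have hLor : ∀ i, G.Adj u (L i) ∨ G.Adj v (L i) := fun i ↦
    (hub_pair_adj_left (hLu i) (hLv i)).1 (hLadj i)
  have hLL : ∀ i, G.Adj (L i) (L (i + 1)) := by
    intro i
    have := hσ.adj' (hLadj i)
    rw [hLs] at this
    exact (hub_pair_adj (hLu _) (hLv _) (hLu _) (hLv _)).1 this
  obtain ⟨j, hj, hLj⟩ := hcov y huy'
  have hj0 : 0 < j := by
    rcases Nat.eq_zero_or_pos j with rfl | h
    · exact (hxy (hL0.symm.trans hLj)).elim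
    · exact h
  have hd' : L d = L 0 := hd.trans hL0.symm
  have A := fun p q r ↦ hG.false_of_interleaved hLL hd' hinj hLu hLv huv (p := p) (q := q) (r := r)
  have B := fun p q r ↦ hG.false_of_interleaved hLL hd' hinj hLv hLu huv.symm (p := p) (q := q)
    (r := r)
  rw [hL0] at A B
  have A' := fun p q r h1 h2 h3 h4 ↦ A p q r h1 h2 h3 h4 hux.1
  have B' := fun p q r h1 h2 h3 h4 ↦ B p q r h1 h2 h3 h4 hux.2
  have hju : G.Adj u (L j) := by rw [hLj]; exact huy.1
  have hjv : G.Adj v (L j) := by rw [hLj]; exact huy.2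
  have hne : ∀ i, 0 < i → i < d → L i ≠ x := by
    intro i h1 h2 h3
    have := hinj i h2 0 hd0 (h3.trans hL0.symm)
    omega
  have hnej : ∀ i, i < d → i ≠ j → L i ≠ y := fun i h1 h2 h3 ↦
    h2 (hinj i h1 j hj (h3.trans hLj.symm))
  have hdy : L d ≠ y := by rw [hd]; exact hxy
  by_cases hcase : (∃ i, 0 < i ∧ i < j ∧ G.Adj u (L i)) ∨ ∃ i, j < i ∧ i < d ∧ G.Adj v (L i)
  · have h1 : ∀ i ≤ j, G.Adj u (L i) := by
      intro i hi
      rcases Nat.eq_zero_or_pos i with rfl | hi0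
      · rw [hL0]; exact hux.1
      rcases hi.eq_or_lt with rfl | hij
      · exact hju
      refine (hLor i).resolve_right fun hiv ↦ ?_
      rcases hcase with ⟨p, hp0, hpj, hpu⟩ | ⟨q, hjq, hqd, hqv⟩
      · rcases lt_trichotomy p i with h | rfl | h
        · exact B' p i j hp0 h hij hj hiv hpu hju
        · have := (hcom _).1 ⟨hpu, hiv⟩
          exact this.elim (hne _ hi0 (by omega)) (hnej _ (by omega) (by omega))
        · exact A' i p j hi0 h hpj hj hpu hiv hjv
      · exact A' i j q hi0 hij hjq hqd hju hiv hqv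
    have h2 : ∀ i, j ≤ i → i ≤ d → G.Adj v (L i) := by
      intro i hi hid
      rcases hi.eq_or_lt with rfl | hji
      · exact hjv
      rcases hid.eq_or_lt with rfl | hid
      · rw [hd]; exact hux.2
      refine (hLor i).resolve_left fun hiu ↦ ?_
      rcases hcase with ⟨p, hp0, hpj, hpu⟩ | ⟨q, hjq, hqd, hqv⟩
      · exact B' p j i hp0 hpj hji hid hjv hpu hiu
      · rcases lt_trichotomy q i with h | rfl | h
        · exact B' j q i hj0 hjq h hid hqv hju hiu
        · have := (hcom _).1 ⟨hiu, hqv⟩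
          exact this.elim (hne _ (by omega) (by omega)) (hnej _ (by omega) (by omega))
        · exact A' j i q hj0 hji h hqd hiu hjv hqv
    refine ⟨y, x, hxy.symm, fun z ↦ by rw [hcom, or_comm], fun b ↦ ∃ i, j ≤ i ∧ i < d ∧ L i = b,
      fun b hb ↦ ?_⟩
    obtain ⟨i, hi, rfl⟩ := hcov b hb
    rw [hLs]
    rcases Nat.lt_or_ge i j with hij | hij
    · refine .inr ⟨?_, h1 i (by omega), h1 _ (by omega), hnej i hi (by omega),
        hne _ (by omega) (by omega)⟩
      rintro ⟨k, hk, hkd, h⟩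
      have := hinj k hkd i hi h
      omega
    · refine .inl ⟨⟨i, hij, hi, rfl⟩, h2 i hij hi.le, h2 _ (by omega) (by omega),
        hne i (by omega) hi, ?_⟩
      rcases Nat.lt_or_ge (i + 1) d with h | h
      · exact hnej _ h (by omega)
      · rwa [show i + 1 = d by omega]
  · push Not at hcase
    have h1 : ∀ i ≤ j, G.Adj v (L i) := by
      intro i hi
      rcases Nat.eq_zero_or_pos i with rfl | hi0
      · rw [hL0]; exact hux.2
      rcases hi.eq_or_lt with rfl | hij
      · exact hjv
      exact (hLor i).resolve_left (hcase.1 i hi0 hij)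
    have h2 : ∀ i, j ≤ i → i ≤ d → G.Adj u (L i) := by
      intro i hi hid
      rcases hi.eq_or_lt with rfl | hji
      · exact hju
      rcases hid.eq_or_lt with rfl | hid
      · rw [hd]; exact hux.1
      exact (hLor i).resolve_right (hcase.2 i hji hid)
    refine ⟨x, y, hxy, hcom, fun b ↦ ∃ i, i < j ∧ L i = b, fun b hb ↦ ?_⟩
    obtain ⟨i, hi, rfl⟩ := hcov b hb
    rw [hLs]
    rcases Nat.lt_or_ge i j with hij | hij
    · exact .inl ⟨⟨i, hij, rfl⟩, h1 i hij.le, h1 _ hij, hnej i hi hij.ne,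
        hne _ (by omega) (by omega)⟩
    · refine .inr ⟨?_, h2 i hij hi.le, h2 _ (by omega) (by omega), hne i (by omega) hi, ?_⟩
      · rintro ⟨k, hk, h⟩
        have := hinj k (by omega) i hi h
        omega
      · rcases Nat.lt_or_ge (i + 1) d with h | h
        · exact hnej _ h (by omega)
        · rwa [show i + 1 = d by omega]

end Rotation

end PlanarSeq

namespace PlanarSeq

open scoped Classical

variable {V : Type*} {G : SimpleGraph V}

section Split

/-- Replacing an interval of a cyclic order by a single new element gives a cyclic order. -/
theorem cyc_splice {N R : V → Prop} {f g : V → V} {s t w : V}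
    (hf : ∀ P : V → Prop, (∃ x, N x ∧ P x) → (∀ x, N x → P x → P (f x)) → ∀ x, N x → P x)
    (hRN : ∀ x, R x → N x) (hs : R s) (ht : R t) (hR : ∀ x, R x → x ≠ t → R (f x))
    (hR' : ∀ x, N x → (x = t ∨ ¬ R x) → R (f x) → f x = s)
    (hgt : g t = w) (hgw : g w = s) (hg : ∀ x, R x → x ≠ t → g x = f x)
    (P : V → Prop) (h0 : ∃ x, (R x ∨ x = w) ∧ P x) (h1 : ∀ x, (R x ∨ x = w) → P x → P (g x)) :
    ∀ x, (R x ∨ x = w) → P x := by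
  have hws : P w → P s := fun h ↦ hgw ▸ h1 w (.inr rfl) h
  have htw : P t → P w := fun h ↦ hgt ▸ h1 t (.inl ht) h
  have hPs : P s := by
    by_contra hcon
    obtain ⟨x, hx, hPx⟩ := h0
    have hxR : R x := hx.resolve_right fun h ↦ hcon (hws (h ▸ hPx))
    refine hcon (hws (htw (hf (fun x ↦ R x ∧ P x) ⟨x, hRN x hxR, hxR, hPx⟩ ?_ t (hRN t ht)).2))
    rintro z hz ⟨hzR, hzP⟩
    have hzt : z ≠ t := fun h ↦ hcon (hws (htw (h ▸ hzP)))
    exact ⟨hR z hzR hzt, hg z hzR hzt ▸ h1 z (.inl hzR) hzP⟩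
  have hall : ∀ x, N x → R x → P x := by
    refine hf (fun x ↦ R x → P x) ⟨s, hRN s hs, fun _ ↦ hPs⟩ ?_
    intro z hz hzP hfz
    by_cases h : z = t ∨ ¬ R z
    · rwa [hR' z hz h hfz]
    · push Not at h
      exact hg z h.2 h.1 ▸ h1 z (.inl h.2) (hzP h.2)
  rintro x (hx | rfl)
  exacts [hall x (hRN x hx) hx, htw (hall t (hRN t ht) ht)]

/-- The rotation obtained by splitting `u` into `u` and `v`; the neighbours in `P` are those
between `x` and `y`. -/
noncomputable def splitRot (σ : V → V → V) (u v x y : V) (P : V → Prop) (a b : V) : V :=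
  if a = u then (if b = x then v else if b = v then y else σ u b)
  else if a = v then (if b = u then x else if b = y then u else σ u b)
  else if b = v then (if a = x then u else σ a u)
  else if b = u then (if a = y then v else σ a u)
  else if σ a b = u ∧ P a then v else σ a b

variable {σ : V → V → V}

theorem Tri.splitRot {u v x y : V} {P : V → Prop} (hσ : Tri (hub G {u, v} u) σ) (huv : G.Adj u v)
    (hxy : x ≠ y) (hcom : ∀ z, (G.Adj u z ∧ G.Adj v z) ↔ z = x ∨ z = y)
    (hP : ∀ b, (hub G {u, v} u).Adj u b →
        (P b ∧ G.Adj v b ∧ G.Adj v (σ u b) ∧ b ≠ y ∧ σ u b ≠ x) ∨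
        (¬ P b ∧ G.Adj u b ∧ G.Adj u (σ u b) ∧ b ≠ x ∧ σ u b ≠ y)) :
    Tri G (splitRot σ u v x y P) := by
  have hux := (hcom x).2 (.inl rfl)
  have huy := (hcom y).2 (.inr rfl)
  have hne := huv.ne
  have hor : ∀ b, b ≠ u → b ≠ v → ((hub G {u, v} u).Adj u b ↔ G.Adj u b ∨ G.Adj v b) :=
    fun b h1 h2 ↦ hub_pair_adj_left h1 h2
  have hor' : ∀ b, b ≠ u → b ≠ v → ((hub G {u, v} u).Adj b u ↔ G.Adj u b ∨ G.Adj v b) :=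
    fun b h1 h2 ↦ by rw [SimpleGraph.adj_comm, hor b h1 h2]
  have hadj : ∀ a b, a ≠ u → a ≠ v → b ≠ u → b ≠ v → ((hub G {u, v} u).Adj a b ↔ G.Adj a b) :=
    fun a b h1 h2 h3 h4 ↦ hub_pair_adj h1 h2 h3 h4
  have hnv : ∀ a b, (hub G {u, v} u).Adj a b → a ≠ v ∧ b ≠ v := fun a b ↦ hub_pair_ne hne
  have hirr : ∀ a b, (hub G {u, v} u).Adj a b → a ≠ b := fun a b h ↦ h.ne
  have hsymm : ∀ a b, G.Adj a b → G.Adj b a := fun a b h ↦ h.symm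
  have hirrG : ∀ a b, G.Adj a b → a ≠ b := fun a b h ↦ h.ne
  have h1 := fun a b ↦ @Tri.adj _ _ _ hσ a b
  have h2 := fun a b ↦ @Tri.adj' _ _ _ hσ a b
  have h3 := fun a b ↦ @Tri.rot _ _ _ hσ a b
  have main : ∀ a b, G.Adj a b → G.Adj a (PlanarSeq.splitRot σ u v x y P a b) ∧
      G.Adj b (PlanarSeq.splitRot σ u v x y P a b) ∧
      PlanarSeq.splitRot σ u v x y P b (PlanarSeq.splitRot σ u v x y P a b) = a := by
    intro a b hab
    by_cases hau : a = u
    · subst hau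
      by_cases hbx : b = x
      · subst hbx
        grind [PlanarSeq.splitRot]
      by_cases hbv : b = v
      · subst hbv
        grind [PlanarSeq.splitRot]
      have hb := (hor b hab.ne' hbv).2 (.inl hab)
      have := hP b hb
      have := h1 _ _ hb
      have := h2 _ _ hb
      have := h3 _ _ hb
      grind [PlanarSeq.splitRot]
    by_cases hav : a = v
    · subst hav
      by_cases hbu : b = u
      · subst hbu
        grind [PlanarSeq.splitRot]
      by_cases hby : b = y
      · subst hby
        grind [PlanarSeq.splitRot]
      have hb := (hor b hbu hab.ne').2 (.inr hab)
      have := hP b hb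
      have := h1 _ _ hb
      have := h2 _ _ hb
      have := h3 _ _ hb
      grind [PlanarSeq.splitRot]
    by_cases hbv : b = v
    · subst hbv
      by_cases hax : a = x
      · subst hax
        grind [PlanarSeq.splitRot]
      have hb := (hor' a hau hav).2 (.inr hab.symm)
      have := h1 _ _ hb
      have h' := h2 _ _ hb
      have := h3 _ _ hb
      have := hP _ h'
      grind [PlanarSeq.splitRot]
    by_cases hbu : b = u
    · subst hbu
      by_cases hay : a = y
      · subst hay
        grind [PlanarSeq.splitRot]
      have hb := (hor' a hau hav).2 (.inl hab.symm)
      have := h1 _ _ hb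
      have h' := h2 _ _ hb
      have := h3 _ _ hb
      have := hP _ h'
      grind [PlanarSeq.splitRot]
    have hb := (hadj a b hau hav hbu hbv).2 hab
    have h4 := h1 _ _ hb
    have h5 := h2 _ _ hb
    have h6 := h3 _ _ hb
    have h7 := hσ.rot' hb
    by_cases hc : σ a b = u
    · rw [hc] at h4 h6 h7
      have h8 := hP a h4.symm
      rw [h7] at h8
      clear h1 h2 h3 hP hor hor' hadj hσ h5
      grind [PlanarSeq.splitRot]
    · clear hP hor hor' hσ
      grind [PlanarSeq.splitRot]
  refine ⟨fun h ↦ (main _ _ h).1, fun h ↦ (main _ _ h).2.1, fun h ↦ (main _ _ h).2.2, ?_⟩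
  intro a
  have hX := (hor x hux.1.ne' hux.2.ne').2 (.inl hux.1)
  have hY := (hor y huy.1.ne' huy.2.ne').2 (.inl huy.1)
  by_cases hau : a = u
  · subst hau
    have key := cyc_splice (R := fun b ↦ G.Adj a b ∧ b ≠ v) (s := y) (t := x) (w := v)
      (g := PlanarSeq.splitRot σ a v x y P a) (hσ.cyc a)
      (fun z hz ↦ (hor z hz.1.ne' hz.2).2 (.inl hz.1)) ⟨huy.1, huy.2.ne'⟩ ⟨hux.1, hux.2.ne'⟩
      (by
        intro z hz hzx
        have hb := (hor z hz.1.ne' hz.2).2 (.inl hz.1)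
        have := hP z hb
        have := h1 _ _ hb
        grind)
      (by
        intro z hz
        have := hP z hz
        have := h1 _ _ hz
        grind)
      (by grind [PlanarSeq.splitRot]) (by grind [PlanarSeq.splitRot])
      (by grind [PlanarSeq.splitRot])
    have hiff : ∀ z, G.Adj a z ↔ (G.Adj a z ∧ z ≠ v) ∨ z = v := by grind
    simpa only [← hiff] using key
  by_cases hav : a = v
  · subst hav
    have key := cyc_splice (R := fun b ↦ G.Adj a b ∧ b ≠ u) (s := x) (t := y) (w := u)
      (g := PlanarSeq.splitRot σ u a x y P a) (hσ.cyc u)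
      (fun z hz ↦ (hor z hz.2 hz.1.ne').2 (.inr hz.1)) ⟨hux.2, hux.1.ne'⟩ ⟨huy.2, huy.1.ne'⟩
      (by
        intro z hz hzx
        have hb := (hor z hz.2 hz.1.ne').2 (.inr hz.1)
        have := hP z hb
        have := h1 _ _ hb
        grind)
      (by
        intro z hz
        have := hP z hz
        have := h1 _ _ hz
        grind)
      (by grind [PlanarSeq.splitRot]) (by grind [PlanarSeq.splitRot])
      (by grind [PlanarSeq.splitRot])
    have hiff : ∀ z, G.Adj a z ↔ (G.Adj a z ∧ z ≠ u) ∨ z = u := by grind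
    simpa only [← hiff] using key
  intro Q h0 hQ
  have hQu : G.Adj a u → Q u → if a = y then Q v else Q (σ a u) := by
    intro h hq
    have := hQ u h hq
    grind [PlanarSeq.splitRot]
  have hQv : G.Adj a v → Q v → if a = x then Q u else Q (σ a u) := by
    intro h hq
    have := hQ v h hq
    grind [PlanarSeq.splitRot]
  have hQb : ∀ b, G.Adj a b → b ≠ u → b ≠ v → Q b →
      if σ a b = u ∧ P a then Q v else Q (σ a b) := by
    intro b h hbu hbv hq
    have := hQ b h hq
    grind [PlanarSeq.splitRot]
  have hxy' : ∀ z, G.Adj z u → G.Adj z v → z = x ∨ z = y := fun z h1 h2 ↦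
    (hcom z).1 ⟨h1.symm, h2.symm⟩
  have hau' : (hub G {u, v} u).Adj a u ↔ G.Adj a u ∨ G.Adj a v := by
    rw [hor' a hau hav, G.adj_comm u, G.adj_comm v]
  have hσu : (hub G {u, v} u).Adj a u → (hub G {u, v} u).Adj a (σ a u) ∧ σ a u ≠ u ∧ σ a u ≠ v :=
    fun h ↦ ⟨h1 _ _ h, (h2 _ _ h).ne', (hnv _ _ (h1 _ _ h)).2⟩
  have hPa : (hub G {u, v} u).Adj a u → P a ∧ G.Adj a v ∧ a ≠ y ∨ ¬ P a ∧ G.Adj a u ∧ a ≠ x := by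
    intro h
    rcases hP a h.symm with h | h
    exacts [.inl ⟨h.1, h.2.1.symm, h.2.2.2.1⟩, .inr ⟨h.1, h.2.1.symm, h.2.2.2.1⟩]
  have hsucc : (hub G {u, v} u).Adj a u → (Q u ∨ Q v) → (G.Adj a u → Q u) → (G.Adj a v → Q v) →
      Q (σ a u) := by
    intro h
    grind
  obtain ⟨b₁, hb₁, hb₁u, hb₁v, hQb₁⟩ : ∃ b, G.Adj a b ∧ b ≠ u ∧ b ≠ v ∧ Q b := by
    obtain ⟨b, hb, hq⟩ := h0
    by_cases hbu : b = u
    · subst hbu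
      have h4 := hau'.2 (.inl hb)
      have h5 := hσu h4
      refine ⟨σ a b, (hadj a _ hau hav h5.2.1 h5.2.2).1 h5.1, h5.2.1, h5.2.2, ?_⟩
      grind
    by_cases hbv : b = v
    · subst hbv
      have h4 := hau'.2 (.inr hb)
      have h5 := hσu h4
      refine ⟨σ a u, (hadj a _ hau hav h5.2.1 h5.2.2).1 h5.1, h5.2.1, h5.2.2, ?_⟩
      grind
    exact ⟨b, hb, hbu, hbv, hq⟩
  have hall := hσ.cyc a (fun b ↦ if b = u then (G.Adj a u → Q u) ∧ (G.Adj a v → Q v) else Q b)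
    ⟨b₁, (hadj a b₁ hau hav hb₁u hb₁v).2 hb₁, by simpa [hb₁u]⟩ ?_
  · intro b hb
    by_cases hbu : b = u
    · have := hall u (hau'.2 (.inl (hbu ▸ hb)))
      rw [if_pos rfl] at this
      exact hbu ▸ this.1 (hbu ▸ hb)
    by_cases hbv : b = v
    · have := hall u (hau'.2 (.inr (hbv ▸ hb)))
      rw [if_pos rfl] at this
      exact hbv ▸ this.2 (hbv ▸ hb)
    · have := hall b ((hadj a b hau hav hbu hbv).2 hb)
      rwa [if_neg hbu] at this
  · intro b hb
    by_cases hbu : b = u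
    · subst hbu
      have h5 := hσu hb
      simp only [if_pos, if_neg h5.2.1]
      intro h6
      refine hsucc hb ?_ h6.1 h6.2
      exact (hau'.1 hb).imp h6.1 h6.2
    · have hbv := (hnv _ _ hb).2
      have h4 := h1 _ _ hb
      have h5 := hQb b ((hadj a b hau hav hbu hbv).1 hb) hbu hbv
      simp only [if_neg hbu]
      intro h6
      have h7 := h5 h6
      by_cases hc : σ a b = u
      · rw [hc] at h4 h7 ⊢
        have h8 := hPa h4
        rw [if_pos rfl]
        clear hP hor hor' hadj hσ h1 h2 h3
        grind
      · rw [if_neg (fun h ↦ hc h.1)] at h7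
        rwa [if_neg hc]

end Split

section Triangulation

theorem exists_tri_triangle {a b c : V} (hab : G.Adj a b) (hac : G.Adj a c) (hbc : G.Adj b c)
    (hS : ∀ u v, G.Adj u v → u ∈ ({a, b, c} : Finset V) ∧ v ∈ ({a, b, c} : Finset V)) :
    ∃ σ, Tri G σ := by
  have hS' : ∀ u v, G.Adj u v → (u = a ∨ u = b ∨ u = c) ∧ (v = a ∨ v = b ∨ v = c) := by
    intro u v h
    simpa using hS u v h
  have hne : ∀ u v, G.Adj u v → u ≠ v := fun u v h ↦ h.ne
  have h1 := hab.symm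
  have h2 := hac.symm
  have h3 := hbc.symm
  refine ⟨fun v x ↦ if v ≠ a ∧ x ≠ a then a else if v ≠ b ∧ x ≠ b then b else c, ?_, ?_, ?_, ?_⟩
  · grind
  · grind
  · grind
  · rintro v P ⟨x, hx, hPx⟩ hP y hy
    have := hP x hx hPx
    grind

theorem e_hub_pair {u v : V} {Y : Finset V} (huv : G.Adj u v) (hu : u ∉ Y) (hv : v ∉ Y) :
    e (hub G {u, v} u) (insert u Y) (insert u Y) + 2 * (nb G (nb G Y u) v).card + 2 =
      e G (insert u (insert v Y)) (insert u (insert v Y)) := by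
  have h1 := e_hub (G := G) (X := {u, v}) (x₀ := u) (by simp) (Y := Y)
    (by rintro y hy (rfl | rfl); exacts [hu hy, hv hy])
  have h2 := nb_inter_card (G := G) Y u v
  simp only [Set.mem_insert_iff, Set.mem_singleton_iff, exists_eq_or_imp, exists_eq_left] at h1
  rw [e_pair hu hv huv, h1]
  omega

theorem hub_pair_support {u v a b : V} (h : (hub G {u, v} u).Adj a b) :
    a = u ∨ ∃ c, G.Adj c a := by
  obtain ⟨-, -, -, h | ⟨rfl, -⟩ | ⟨rfl, c, -, h⟩⟩ := h
  exacts [.inr ⟨b, h.symm⟩, .inl rfl, .inr ⟨c, h⟩]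

/-- A planar graph attaining the edge bound has a rotation system all of whose faces are
triangles. -/
theorem exists_tri (n : ℕ) (hn : 3 ≤ n) : ∀ (G : SimpleGraph V) (S : Finset V), S.card = n →
    (∀ u v, G.Adj u v → u ∈ S ∧ v ∈ S) → HT G → e G S S + 12 = 6 * n → ∃ σ, Tri G σ := by
  induction n, hn using Nat.le_induction with
  | base =>
    intro G S hS hsupp hG he
    obtain ⟨a, b, c, hab, hac, hbc, rfl⟩ := Finset.card_eq_three.1 hS
    rw [e_insert (by simp [hab, hac]), e_insert (by simp [hbc]), e_singleton_left,
      nb_singleton_self] at he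
    simp only [nb, Finset.filter_insert, Finset.filter_singleton] at he
    by_cases h1 : G.Adj a b <;> by_cases h2 : G.Adj a c <;> by_cases h3 : G.Adj b c <;>
      simp [h1, h2, h3, hbc] at he
    exact exists_tri_triangle h1 h2 h3 hsupp
  | succ n hn ih =>
    intro G S hS hsupp hG he
    have hdeg : ∃ v ∈ S, (nb G S v).card ≤ 5 := by
      by_contra! hcon
      have := Finset.card_nsmul_le_sum S (fun v ↦ (nb G S v).card) 6 hcon
      rw [← e_eq_sum_card, smul_eq_mul, hS] at this
      omega
    obtain ⟨v, hv, hdv⟩ := hdeg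
    have hpos : (nb G S v).Nonempty := by
      rw [Finset.nonempty_iff_ne_empty]
      intro h0
      have h1 := e_insert (G := G) (Finset.notMem_erase v S)
      have h2 : nb G (S.erase v) v = ∅ := by
        rw [← Finset.subset_empty, ← h0]
        exact Finset.filter_subset_filter _ (Finset.erase_subset _ _)
      have hc : (S.erase v).card = n := by
        rw [Finset.card_erase_of_mem hv, hS, Nat.add_sub_cancel]
      have h3 := hG.edge_bound (Y := S.erase v) (by omega)
      rw [Finset.insert_erase hv, h2, Finset.card_empty] at h1
      omega
    obtain ⟨u, hu, hle⟩ := hG.exists_edge_of_nb_card_le hpos hdv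
    rw [mem_nb] at hu
    have huv : G.Adj u v := hu.2.symm
    have huS := hu.1
    obtain ⟨Y, hY⟩ : ∃ Y, Y = (S.erase v).erase u := ⟨_, rfl⟩
    have huv' : u ∈ S.erase v := Finset.mem_erase.2 ⟨huv.ne, huS⟩
    have hinsu : insert u Y = S.erase v := by rw [hY, Finset.insert_erase huv']
    have hins : insert v (insert u Y) = S := by rw [hinsu, Finset.insert_erase hv]
    have hYc : Y.card = n - 1 := by
      rw [hY, Finset.card_erase_of_mem huv', Finset.card_erase_of_mem hv, hS, Nat.add_sub_cancel]
    have huY : u ∉ Y := by simp [hY]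
    have hvY : v ∉ Y := by simp [hY]
    have heq : nb G (nb G Y v) u = nb G (nb G S v) u := by
      ext z
      simp only [mem_nb, hY, Finset.mem_erase]
      exact ⟨fun h ↦ ⟨⟨h.1.1.2.2, h.1.2⟩, h.2⟩,
        fun h ↦ ⟨⟨⟨h.2.ne', h.1.2.ne', h.1.1⟩, h.1.2⟩, h.2⟩⟩
    have htwo : (nb G (nb G Y v) u).card = 2 := by
      have h1 := hG.edge_bound_common (Y := Y) (by omega) huv.symm hvY huY
      rw [hins] at h1
      rw [heq] at h1 ⊢
      omega
    obtain ⟨x, y, hxy, hcom⟩ := Finset.card_eq_two.1 htwo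
    have hcom' : ∀ z, (G.Adj u z ∧ G.Adj v z) ↔ z = x ∨ z = y := by
      intro z
      have := Finset.ext_iff.1 hcom z
      rw [heq] at this
      simp only [mem_nb, Finset.mem_insert, Finset.mem_singleton] at this
      rw [← this]
      exact ⟨fun h ↦ ⟨⟨(hsupp _ _ h.1).2, h.2⟩, h.1⟩, fun h ↦ ⟨h.2, h.1.2⟩⟩
    have hhub : HT (hub G {u, v} u) := hG.ht_hub ((conn_singleton v).insert rfl huv) (by simp)
    have hcard : e (hub G {u, v} u) (insert u Y) (insert u Y) + 12 = 6 * n := by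
      have h1 := e_hub_pair huv huY hvY
      have h2 : (nb G (nb G Y u) v).card = 2 := by
        rw [← htwo]
        congr 1
        ext z
        simp only [mem_nb]
        tauto
      rw [Finset.insert_comm, hins] at h1
      omega
    obtain ⟨σ, hσ⟩ := ih (hub G {u, v} u) (insert u Y)
      (by rw [Finset.card_insert_of_notMem huY, hYc]; omega)
      (by
        intro a b hab
        rw [hinsu]
        have hmem : ∀ a b, (hub G {u, v} u).Adj a b → a ∈ S.erase v := by
          intro a b hab
          refine Finset.mem_erase.2 ⟨(hub_pair_ne huv.ne hab).1, ?_⟩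
          rcases hub_pair_support hab with rfl | ⟨c, hc⟩
          exacts [huS, (hsupp _ _ hc).2]
        exact ⟨hmem a b hab, hmem b a hab.symm⟩)
      hhub hcard
    obtain ⟨x, y, hxy, hcom, P, hP⟩ := hG.exists_split huv hxy hcom' hσ
    exact ⟨_, hσ.splitRot huv hxy hcom hP⟩

end Triangulation

end PlanarSeq

namespace PlanarSeq

section Search

/-- `branch c t e` is `if c then t else e`, in a form that the kernel reduces quickly. -/
def branch (c t e : Bool) : Bool := Bool.rec e t c

/-- `force n f` is `f n`, evaluated after `n` has been reduced to a numeral. -/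
def force (n : ℕ) (f : ℕ → Bool) : Bool := Nat.rec (f 0) (fun m _ ↦ f (Nat.succ m)) n

/-- The `(i, j)` entry of a Boolean matrix with rows of length 32 packed into a number. -/
def entry (D i j : ℕ) : Bool :=
  Nat.beq (Nat.land 1 (Nat.shiftRight D (Nat.add (Nat.mul 32 i) j))) 1

/-- The row `i` of a packed Boolean matrix. -/
def row (D i : ℕ) : ℕ := Nat.mod (Nat.shiftRight D (Nat.mul 32 i)) 4294967296

/-- Set the `(i, j)` entry of a packed Boolean matrix. -/
def setEntry (D i j : ℕ) : ℕ := Nat.lor D (Nat.shiftLeft 1 (Nat.add (Nat.mul 32 i) j))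

/-- The digit `i` of `R` in base 16. -/
def digit (R i : ℕ) : ℕ := Nat.mod (Nat.shiftRight R (Nat.mul 4 i)) 16

/-- If all darts at `i` have both faces known, then no edge at `i` is missing. -/
def closedOk (D E R i : ℕ) : Bool :=
  branch (Nat.beq (row D i) (row E i)) (Nat.beq (digit R i) 0) true

/-- Add an edge between `i` and `j` unless `c` says that it is known. The base 16 digits of `R`
are the numbers of missing edges at the vertices. -/
def addEdge (c : Bool) (R i j : ℕ) (k : ℕ → Bool) : Bool :=
  branch c (k R) <| branch (Nat.beq (digit R i) 0) true <| branch (Nat.beq (digit R j) 0) true <|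
    force (Nat.sub (Nat.sub R (Nat.pow 16 i)) (Nat.pow 16 j)) k

/-- Add the face `v x y` to the matrix `D` of darts with known left face, whose transpose
is `E`. -/
def addFace (D E R v x y : ℕ) (k : ℕ → ℕ → ℕ → Bool) : Bool :=
  addEdge (entry D y x) R x y fun R ↦ addEdge (entry D v y) R v y fun R ↦
  force (setEntry (setEntry (setEntry D v x) x y) y v) fun D ↦
  force (setEntry (setEntry (setEntry E x v) y x) v y) fun E ↦
  branch (closedOk D E R v) (branch (closedOk D E R x) (branch (closedOk D E R y)
    (k D E R) true) true) true

/-- Choose a vertex with an unknown face and few missing edges. -/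
def choose (D E R n r best : ℕ) (k : ℕ → Bool) : Bool :=
  Nat.rec (motive := fun _ ↦ ℕ → ℕ → Bool) (fun _ best ↦ k best)
    (fun i ih r best ↦ branch (Nat.beq (row D i) (row E i)) (ih r best) <|
      branch (Nat.beq (digit R i) 0) (k i) <|
      branch (Nat.ble (Nat.succ (digit R i)) r) (force (digit R i) fun r ↦ ih r i) (ih r best))
    n r best

/-- `p i` for all `i < n`. -/
def forallLT (n : ℕ) (p : ℕ → Bool) : Bool :=
  Nat.rec true (fun i ih ↦ branch (p i) ih false) n

/-- One step of `search`, which branches over the left face of a dart `v x`. -/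
def searchStep (ih : (n D E R a b : ℕ) → Bool) (n D E R a b : ℕ) : Bool :=
  branch (Nat.beq (Nat.land D E) E) (Nat.ble n 18) <|
  choose D E R n 16 0 fun v ↦
  force (Nat.log2 (Nat.sub (row E v) (Nat.land (row E v) (row D v)))) fun x ↦
  branch (Nat.ble (Nat.succ v) n) (branch (Nat.ble (Nat.succ x) n)
  (branch (entry D x v) (branch (entry D v x) false
  (branch (branch (Nat.beq (digit R v) 0) true <|
    branch (branch (Nat.beq a 0) true
    (force (Nat.add R (Nat.mul 7 (Nat.pow 16 n))) fun R ↦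
      addFace D E R v x n fun D E R ↦ ih (Nat.succ n) D E R (Nat.pred a) b))
    (branch (Nat.beq b 0) true
    (force (Nat.add R (Nat.mul 5 (Nat.pow 16 n))) fun R ↦
      addFace D E R v x n fun D E R ↦ ih (Nat.succ n) D E R a (Nat.pred b))) false)
    (force (setEntry (setEntry (Nat.lor (row D x) (row E v)) 0 v) 0 x) fun M ↦
    forallLT n fun y ↦ branch (entry M 0 y) true <|
      addFace D E R v x y fun D E R ↦ ih n D E R a b) false)) false) false) false

/-- Exhaustive search for a triangulation on 19 vertices that extends a partial one, with `n` known
vertices and at most `a` and `b` unknown vertices of degree 7 and 5; the result `true` means that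
there is none. -/
def search (fuel : ℕ) : (n D E R a b : ℕ) → Bool :=
  Nat.rec (fun _ _ _ _ _ _ ↦ false) (fun _ ih ↦ searchStep ih) fuel

theorem branch_eq_true {c t e : Bool} :
    branch c t e = true ↔ (c = true ∧ t = true) ∨ (c = false ∧ e = true) := by
  cases c <;> simp [branch]

theorem force_eq (n : ℕ) (f : ℕ → Bool) : force n f = f n := by
  cases n <;> rfl

theorem entry_eq (D i j : ℕ) : entry D i j = D.testBit (32 * i + j) := by
  change Nat.beq (1 &&& (D >>> (32 * i + j))) 1 = _
  rw [Nat.testBit, Nat.one_and_eq_mod_two]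
  rcases Nat.mod_two_eq_zero_or_one (D >>> (32 * i + j)) with h | h <;> rw [h] <;> rfl

theorem testBit_row (D i j : ℕ) (hj : j < 32) : (row D i).testBit j = D.testBit (32 * i + j) := by
  change ((D >>> (32 * i)) % 2 ^ 32).testBit j = _
  rw [Nat.testBit_mod_two_pow, Nat.testBit_shiftRight, decide_eq_true hj, Bool.true_and]

theorem entry_setEntry (D : ℕ) {i j p q : ℕ} (hj : j < 32) (hq : q < 32) :
    entry (setEntry D i j) p q = (entry D p q || decide (p = i ∧ q = j)) := by
  rw [entry_eq, entry_eq]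
  change (D ||| (1 <<< (32 * i + j))).testBit _ = _
  rw [Nat.testBit_or, Nat.one_shiftLeft, Nat.testBit_two_pow]
  congr 1
  simp only [decide_eq_decide]
  omega

theorem digit_eq (R i : ℕ) : digit R i = R / 16 ^ i % 16 := by
  change R >>> (4 * i) % 16 = _
  rw [Nat.shiftRight_eq_div_pow, pow_mul]
  norm_num

theorem digit_sum {n : ℕ} {r : ℕ → ℕ} (hr : ∀ i < n, r i < 16) {i : ℕ} (hi : i < n) :
    digit (∑ j ∈ Finset.range n, r j * 16 ^ j) i = r i := by
  rw [digit_eq]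
  induction n generalizing r i with
  | zero => omega
  | succ n ih =>
    rw [Finset.sum_range_succ']
    have e : ∑ j ∈ Finset.range n, r (j + 1) * 16 ^ (j + 1) =
        16 * ∑ j ∈ Finset.range n, r (j + 1) * 16 ^ j := by
      rw [Finset.mul_sum]
      exact Finset.sum_congr rfl fun _ _ ↦ by ring
    rw [e]
    have h0 := hr 0 (by omega)
    cases i with
    | zero => simp; omega
    | succ i =>
      rw [pow_succ', ← Nat.div_div_eq_div_mul, show (16 * (∑ j ∈ Finset.range n, r (j + 1) * 16 ^ j)
        + r 0 * 16 ^ 0) / 16 = ∑ j ∈ Finset.range n, r (j + 1) * 16 ^ j by omega]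
      exact ih (fun j hj ↦ hr (j + 1) (by omega)) (by omega)

theorem exists_of_choose {D E R n r best : ℕ} {k : ℕ → Bool}
    (h : choose D E R n r best k = true) : ∃ i, k i = true := by
  induction n generalizing r best with
  | zero => exact ⟨_, h⟩
  | succ n ih =>
    change branch _ (choose D E R n r best k) (branch _ (k n) (branch _
      (force (digit R n) fun r ↦ choose D E R n r n k) (choose D E R n r best k))) = true at h
    simp only [branch_eq_true, force_eq] at h
    rcases h with h | ⟨-, h | ⟨-, h | h⟩⟩
    · exact ih h.2
    · exact ⟨_, h.2⟩
    · exact ih h.2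
    · exact ih h.2

theorem of_forallLT {n : ℕ} {p : ℕ → Bool} (h : forallLT n p = true) {i : ℕ} (hi : i < n) :
    p i = true := by
  induction n with
  | zero => omega
  | succ n ih =>
    change branch (p n) (forallLT n p) false = true at h
    simp only [branch_eq_true, Bool.false_eq_true, and_false, or_false] at h
    rcases Nat.lt_succ_iff_lt_or_eq.1 hi with hi | rfl
    · exact ih h.2 hi
    · exact h.1

section Sound

open scoped Classical

variable {V : Type*} [Fintype V] {T : SimpleGraph V} {σ : V → V → V} {S : Finset V}

/-- A partial triangulation: `f i` for `i < n` are the known vertices, `d i j` means that the left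
face of the dart from `i` to `j` is known, `kn i j` means that the edge between `i` and `j` is
known, `r i` is the number of missing edges at `i`. -/
structure Partial (T : SimpleGraph V) (σ : V → V → V) (S : Finset V) (f : ℕ → V) (n a b : ℕ)
    (d kn : ℕ → ℕ → Prop) (r : ℕ → ℕ) : Prop where
  inj : ∀ i < n, ∀ j < n, f i = f j → i = j
  mem : ∀ i < n, f i ∈ S
  known : ∀ i j, kn i j → i < n ∧ j < n ∧ T.Adj (f i) (f j) ∧ kn j i
  face : ∀ i j, d i j → kn i j ∧ ∃ k < n, σ (f i) (f j) = f k ∧ d j k ∧ d k i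
  deg : ∀ i < n, r i + ((Finset.range n).filter (kn i)).card = (nb T Finset.univ (f i)).card
  seven : (S.filter fun z ↦ (∀ i < n, f i ≠ z) ∧ (nb T Finset.univ z).card = 7).card ≤ a
  five : (S.filter fun z ↦ (∀ i < n, f i ≠ z) ∧ (nb T Finset.univ z).card = 5).card ≤ b
  seven_or_five : ∀ z ∈ S, (∀ i < n, f i ≠ z) →
    (nb T Finset.univ z).card = 7 ∨ (nb T Finset.univ z).card = 5

variable {f : ℕ → V} {n a b : ℕ} {d kn : ℕ → ℕ → Prop} {r : ℕ → ℕ}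

theorem Partial.le (h : Partial T σ S f n a b d kn r) : n ≤ S.card := by
  rw [← Finset.card_range n]
  refine Finset.card_le_card_of_injOn f (fun i hi ↦ h.mem i (by simpa using hi)) ?_
  intro i hi j hj e
  exact h.inj i (by simpa using hi) j (by simpa using hj) e

theorem Partial.pos (h : Partial T σ S f n a b d kn r) {i : ℕ} {z : V} (hi : i < n)
    (hz : T.Adj (f i) z) (hk : ∀ j, kn i j → f j ≠ z) : 0 < r i := by
  have h1 := h.deg i hi
  have h2 : ((Finset.range n).filter (kn i)).card < (nb T Finset.univ (f i)).card := by
    rw [← Finset.card_image_of_injOn (f := f)]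
    · refine Finset.card_lt_card (Finset.ssubset_iff.2 ⟨z, ?_, ?_⟩)
      · simp only [Finset.mem_image, Finset.mem_filter]
        rintro ⟨j, ⟨-, hj⟩, e⟩
        exact hk j hj e
      · intro w hw
        rw [Finset.mem_insert, Finset.mem_image] at hw
        rcases hw with rfl | ⟨j, hj, rfl⟩
        · simpa [mem_nb] using hz
        · simpa [mem_nb] using (h.known i j (Finset.mem_filter.1 hj).2).2.2.1
    · intro i hi j hj e
      simp only [Finset.coe_filter, Finset.mem_range, Set.mem_ofPred_eq] at hi hj
      exact h.inj i hi.1 j hj.1 e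
  omega

theorem Partial.addEdge (h : Partial T σ S f n a b d kn r) {i j : ℕ} (hi : i < n) (hj : j < n)
    (hij : T.Adj (f i) (f j)) (hk : ¬ kn i j) :
    Partial T σ S f n a b d (fun p q ↦ kn p q ∨ (p = i ∧ q = j) ∨ (p = j ∧ q = i))
      (fun p ↦ if p = i ∨ p = j then r p - 1 else r p) := by
  have hne : i ≠ j := by rintro rfl; exact hij.ne rfl
  have hk' : ¬ kn j i := fun h' ↦ hk (h.known _ _ h').2.2.2
  refine ⟨h.inj, h.mem, ?_, ?_, ?_, h.seven, h.five, h.seven_or_five⟩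
  · rintro p q (hpq | ⟨rfl, rfl⟩ | ⟨rfl, rfl⟩)
    · have := h.known p q hpq
      tauto
    · exact ⟨hi, hj, hij, by tauto⟩
    · exact ⟨hj, hi, hij.symm, by tauto⟩
  · intro p q hpq
    exact ⟨.inl (h.face p q hpq).1, (h.face p q hpq).2⟩
  · have key : ∀ p q, p < n → q < n → p ≠ q → T.Adj (f p) (f q) → ¬ kn p q →
        (p = i ∧ q = j) ∨ (p = j ∧ q = i) →
        r p - 1 +
          ((Finset.range n).filter fun t ↦ kn p t ∨ (p = i ∧ t = j) ∨ (p = j ∧ t = i)).card =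
          (nb T Finset.univ (f p)).card := by
      intro p q hp hq hpq hadj hkn hor
      have e : ((Finset.range n).filter fun t ↦ kn p t ∨ (p = i ∧ t = j) ∨ (p = j ∧ t = i)) =
          insert q ((Finset.range n).filter (kn p)) := by
        ext t
        simp only [Finset.mem_filter, Finset.mem_range, Finset.mem_insert]
        grind
      rw [e, Finset.card_insert_of_notMem (by simp [hkn]), ← h.deg p hp]
      have := h.pos hp hadj fun t ht e ↦ hkn (h.inj t (h.known _ _ ht).2.1 q hq e ▸ ht)
      omega
    intro p hp
    split_ifs with hpp
    · rcases hpp with rfl | rfl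
      · convert key _ _ hi hj hne hij hk (by tauto)
      · convert key _ _ hj hi hne.symm hij.symm hk' (by tauto)
    · rw [← h.deg p hp]
      congr 2
      ext t
      simp only [Finset.mem_filter, Finset.mem_range]
      tauto

theorem Partial.extend (h : Partial T σ S f n a b d kn r) {z : V} (hz : z ∈ S)
    (hn : ∀ i < n, f i ≠ z) {f' : ℕ → V} {a' b' : ℕ} {r' : ℕ → ℕ} (hf : ∀ i < n, f' i = f i)
    (hfz : f' n = z) (hr : ∀ i < n, r' i = r i) (hrn : r' n = (nb T Finset.univ z).card)
    (ha : a ≤ a' + if (nb T Finset.univ z).card = 7 then 1 else 0)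
    (hb : b ≤ b' + if (nb T Finset.univ z).card = 5 then 1 else 0) :
    Partial T σ S f' (n + 1) a' b' d kn r' := by
  have count : ∀ {c m m' : ℕ},
      (S.filter fun y ↦ (∀ i < n, f i ≠ y) ∧ (nb T Finset.univ y).card = c).card ≤ m →
      (m ≤ m' + if (nb T Finset.univ z).card = c then 1 else 0) →
      (S.filter fun y ↦ (∀ i < n + 1, f' i ≠ y) ∧ (nb T Finset.univ y).card = c).card ≤ m' := by
    intro c m m' h1 h2
    have hs : (S.filter fun y ↦ (∀ i < n + 1, f' i ≠ y) ∧ (nb T Finset.univ y).card = c) ⊆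
        (S.filter fun y ↦ (∀ i < n, f i ≠ y) ∧ (nb T Finset.univ y).card = c).erase z := by
      intro y hy
      simp only [Finset.mem_filter, Finset.mem_erase] at hy ⊢
      exact ⟨fun e ↦ hy.2.1 n (by omega) (hfz.trans e.symm), hy.1,
        fun i hi ↦ hf i hi ▸ hy.2.1 i (by omega), hy.2.2⟩
    have hc := Finset.card_le_card hs
    split_ifs at h2 with h3
    · rw [Finset.card_erase_of_mem (by simp [hz, h3]; exact hn)] at hc
      omega
    · have := Finset.card_erase_le
        (s := S.filter fun y ↦ (∀ i < n, f i ≠ y) ∧ (nb T Finset.univ y).card = c) (a := z)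
      omega
  refine ⟨?_, ?_, ?_, ?_, ?_, count h.seven ha, count h.five hb, ?_⟩
  · intro i hi j hj e
    rcases Nat.lt_succ_iff_lt_or_eq.1 hi with hi | rfl <;>
      rcases Nat.lt_succ_iff_lt_or_eq.1 hj with hj | rfl
    · exact h.inj i hi j hj (by rw [← hf i hi, e, hf j hj])
    · exact absurd (by rw [← hf i hi, e, hfz]) (hn i hi)
    · exact absurd (by rw [← hf j hj, ← e, hfz]) (hn j hj)
    · rfl
  · intro i hi
    rcases Nat.lt_succ_iff_lt_or_eq.1 hi with hi | rfl
    · exact hf i hi ▸ h.mem i hi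
    · exact hfz ▸ hz
  · intro i j hij
    obtain ⟨h1, h2, h3, h4⟩ := h.known i j hij
    exact ⟨by omega, by omega, by rwa [hf i h1, hf j h2], h4⟩
  · intro i j hij
    obtain ⟨h1, k, hk, e, h2⟩ := h.face i j hij
    obtain ⟨h3, h4, -⟩ := h.known i j h1
    exact ⟨h1, k, by omega, by rw [hf i h3, hf j h4, hf k hk, e], h2⟩
  · intro i hi
    rw [Finset.range_add_one, Finset.filter_insert,
      if_neg fun h' ↦ absurd (h.known _ _ h').2.1 (lt_irrefl n)]
    rcases Nat.lt_succ_iff_lt_or_eq.1 hi with hi | rfl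
    · rw [hf i hi, hr i hi, h.deg i hi]
    · rw [Finset.filter_false_of_mem fun j _ h' ↦ absurd (h.known _ _ h').1 (lt_irrefl _), hfz, hrn]
      rfl
  · intro y hy hfy
    exact h.seven_or_five y hy fun i hi ↦ hf i hi ▸ hfy i (by omega)

theorem Partial.third (hT : Tri T σ) (h : Partial T σ S f n a b d kn r) {v x y : ℕ}
    (hxv : d x v) (hvx : ¬ d v x) (hy : σ (f v) (f x) = f y) :
    y ≠ v ∧ y ≠ x ∧ ¬ d x y ∧ ¬ d y v := by
  obtain ⟨hx, hv, hadj, -⟩ := h.known _ _ (h.face _ _ hxv).1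
  have h1 := hT.adj hadj.symm
  have h2 := hT.adj' hadj.symm
  rw [hy] at h1 h2
  refine ⟨?_, ?_, fun h3 ↦ ?_, fun h3 ↦ ?_⟩
  · rintro rfl; exact h1.ne rfl
  · rintro rfl; exact h2.ne rfl
  · obtain ⟨-, k, hk, e, -, h4⟩ := h.face _ _ h3
    rw [← hy, hT.rot hadj.symm] at e
    exact hvx (h.inj _ hv _ hk e ▸ h4)
  · obtain ⟨-, k, hk, e, h4, -⟩ := h.face _ _ h3
    rw [← hy, hT.rot' hadj.symm] at e
    exact hvx (h.inj _ hx _ hk e ▸ h4)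

theorem Partial.addFace (h : Partial T σ S f n a b d kn r) {v x y : ℕ}
    (hvx : kn v x) (hxy : kn x y) (hyv : kn y v) (h1 : σ (f v) (f x) = f y)
    (h2 : σ (f x) (f y) = f v) (h3 : σ (f y) (f v) = f x) :
    Partial T σ S f n a b
      (fun p q ↦ d p q ∨ (p = v ∧ q = x) ∨ (p = x ∧ q = y) ∨ (p = y ∧ q = v)) kn r := by
  refine ⟨h.inj, h.mem, h.known, ?_, h.deg, h.seven, h.five, h.seven_or_five⟩
  have hv := (h.known _ _ hvx).1
  have hx := (h.known _ _ hxy).1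
  have hy := (h.known _ _ hyv).1
  rintro i j (hij | ⟨rfl, rfl⟩ | ⟨rfl, rfl⟩ | ⟨rfl, rfl⟩)
  · obtain ⟨h4, k, hk, e, h5, h6⟩ := h.face i j hij
    exact ⟨h4, k, hk, e, .inl h5, .inl h6⟩
  · exact ⟨hvx, y, hy, h1, by tauto, by tauto⟩
  · exact ⟨hxy, v, hv, h2, by tauto, by tauto⟩
  · exact ⟨hyv, x, hx, h3, by tauto, by tauto⟩

theorem Partial.exists_of_closed (hT : Tri T σ) (h : Partial T σ S f n a b d kn r) {q j : ℕ}
    (hq : ∀ i, d i q → d q i) (hj : d q j) {z : V} (hz : T.Adj (f q) z) :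
    ∃ i, d q i ∧ f i = z := by
  refine hT.cyc (f q) (fun z ↦ ∃ i, d q i ∧ f i = z) ?_ ?_ z hz
  · exact ⟨f j, (h.known _ _ (h.face _ _ hj).1).2.2.1, j, hj, rfl⟩
  · rintro _ - ⟨i, hi, rfl⟩
    obtain ⟨-, k, -, e, -, h2⟩ := h.face _ _ hi
    exact ⟨k, hq k h2, e.symm⟩

theorem Partial.eq_zero_of_closed (hT : Tri T σ) (h : Partial T σ S f n a b d kn r) {q j : ℕ}
    (hq : ∀ i, d i q → d q i) (hj : d q j) : r q = 0 := by
  have hqn := (h.known _ _ (h.face _ _ hj).1).1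
  have h1 := h.deg q hqn
  have h2 : (nb T Finset.univ (f q)).card ≤ ((Finset.range n).filter (kn q)).card := by
    refine (Finset.card_le_card fun z hz ↦ ?_).trans (Finset.card_image_le (f := f))
    obtain ⟨i, hi, rfl⟩ := h.exists_of_closed hT hq hj (by simpa [mem_nb] using hz)
    have h3 := (h.face _ _ hi).1
    exact Finset.mem_image.2 ⟨i, by simp [h3, (h.known _ _ h3).2.1], rfl⟩
  omega

/-- The numbers `D`, `E`, `R` encode a partial triangulation. -/
structure Code (n : ℕ) (d : ℕ → ℕ → Prop) (r : ℕ → ℕ) (D E R : ℕ) : Prop where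
  dart : ∀ i < 32, ∀ j < 32, entry D i j = true ↔ d i j
  dart' : ∀ i < 32, ∀ j < 32, entry E i j = true ↔ d j i
  lt : ∀ i < n, r i < 16
  sum : R = ∑ i ∈ Finset.range n, r i * 16 ^ i

theorem Code.digit {D E R i : ℕ} (h : Code n d r D E R) (hi : i < n) : digit R i = r i := by
  rw [h.sum, digit_sum h.lt hi]

theorem Code.addEdge {D E R i j : ℕ} (h : Code n d r D E R) (hi : i < n) (hj : j < n)
    (hij : i ≠ j) (hri : 0 < r i) (hrj : 0 < r j) :
    Code n d (fun p ↦ if p = i ∨ p = j then r p - 1 else r p) D E (R - 16 ^ i - 16 ^ j) := by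
  refine ⟨h.dart, h.dart', fun p hp ↦ ?_, ?_⟩
  · have := h.lt p hp
    split_ifs <;> omega
  · have e : R = ∑ p ∈ Finset.range n, (if p = i ∨ p = j then r p - 1 else r p) * 16 ^ p +
        16 ^ i + 16 ^ j := by
      have e1 : ∀ t < n, 16 ^ t = ∑ p ∈ Finset.range n, if p = t then 16 ^ p else 0 := fun t ht ↦ by
        rw [Finset.sum_ite_eq', if_pos (Finset.mem_range.2 ht)]
      rw [h.sum, e1 i hi, e1 j hj, ← Finset.sum_add_distrib, ← Finset.sum_add_distrib]
      refine Finset.sum_congr rfl fun p _ ↦ ?_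
      have e2 : ∀ m, 0 < m → m * 16 ^ p = (m - 1) * 16 ^ p + 16 ^ p := fun m hm ↦ by
        obtain ⟨m, rfl⟩ := Nat.exists_eq_succ_of_ne_zero hm.ne'
        simp [Nat.succ_mul]
      rcases eq_or_ne p i with rfl | hpi
      · simp [hij, e2 _ hri]
      · rcases eq_or_ne p j with rfl | hpj
        · simp [hpi, e2 _ hrj]
        · simp [hpi, hpj]
    omega

theorem Partial.addEdge_sound (h : Partial T σ S f n a b d kn r) {D E R i j : ℕ} {c : Bool}
    {k : ℕ → Bool} (hc : Code n d r D E R) (hi : i < n) (hj : j < n) (hij : T.Adj (f i) (f j))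
    (hcc : c = true ↔ kn i j) (hk : PlanarSeq.addEdge c R i j k = true) :
    ∃ kn' r' R', (∀ p q, kn' p q ↔ kn p q ∨ (p = i ∧ q = j) ∨ (p = j ∧ q = i)) ∧
      Partial T σ S f n a b d kn' r' ∧ Code n d r' D E R' ∧ k R' = true := by
  by_cases hkn : kn i j
  · rw [PlanarSeq.addEdge, hcc.2 hkn] at hk
    have := (h.known _ _ hkn).2.2.2
    exact ⟨kn, r, R, by grind, h, hc, hk⟩
  · have hc' : c = false := by simpa [hkn] using hcc
    have hri := h.pos hi hij fun t ht e ↦ hkn (h.inj t (h.known _ _ ht).2.1 j hj e ▸ ht)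
    have hrj := h.pos hj hij.symm fun t ht e ↦
      hkn ((h.inj t (h.known _ _ ht).2.1 i hi e ▸ (h.known _ _ ht).2.2.2))
    simp only [PlanarSeq.addEdge, branch_eq_true, force_eq, hc', hc.digit hi, hc.digit hj,
      Nat.beq_eq, hri.ne', hrj.ne', Bool.false_eq_true, false_and, false_or, true_and] at hk
    have hne : i ≠ j := by rintro rfl; exact hij.ne rfl
    exact ⟨_, _, _, fun _ _ ↦ Iff.rfl, h.addEdge hi hj hij hkn, hc.addEdge hi hj hne hri hrj,
      by tauto⟩

theorem Partial.closedOk (hT : Tri T σ) (h : Partial T σ S f n a b d kn r) (hS : S.card ≤ 32)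
    {D E R q j : ℕ} (hc : Code n d r D E R) (hj : d q j) : PlanarSeq.closedOk D E R q = true := by
  have hn := h.le
  have hqn := (h.known _ _ (h.face _ _ hj).1).1
  rw [PlanarSeq.closedOk, branch_eq_true]
  rcases hb : Nat.beq (row D q) (row E q) with _ | _
  · simp
  · refine .inl ⟨rfl, ?_⟩
    rw [hc.digit hqn, h.eq_zero_of_closed hT (fun i hi ↦ ?_) hj]
    · rfl
    · have hi' := (h.known _ _ (h.face _ _ hi).1).1
      rw [← hc.dart q (by omega) i (by omega), entry_eq, ← testBit_row _ _ _ (by omega),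
        Nat.eq_of_beq_eq_true hb, testBit_row _ _ _ (by omega), ← entry_eq,
        hc.dart' q (by omega) i (by omega)]
      exact hi

theorem Partial.addFace_sound (hT : Tri T σ) (h : Partial T σ S f n a b d kn r)
    (hS : S.card ≤ 32) (hkn : ∀ i j, kn i j ↔ d i j ∨ d j i) {D E R v x y : ℕ}
    {k : ℕ → ℕ → ℕ → Bool} (hc : Code n d r D E R) (hxv : d x v) (hvx : ¬ d v x)
    (hy : σ (f v) (f x) = f y) (hyn : y < n) (hk : PlanarSeq.addFace D E R v x y k = true) :
    ∃ d' kn' r' D' E' R', Partial T σ S f n a b d' kn' r' ∧ (∀ i j, kn' i j ↔ d' i j ∨ d' j i) ∧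
      Code n d' r' D' E' R' ∧ (∃ i j, d' i j) ∧ k D' E' R' = true := by
  have hn := h.le
  obtain ⟨hx, hv, hadj, hvx'⟩ := h.known _ _ (h.face _ _ hxv).1
  obtain ⟨hyv, hyx, hxy, hyv'⟩ := h.third hT hxv hvx hy
  have hxv' : x ≠ v := by rintro rfl; exact hadj.ne rfl
  have hvy := hT.adj hadj.symm
  have hxy' := hT.adj' hadj.symm
  rw [hy] at hvy hxy'
  obtain ⟨kn₁, r₁, R₁, hkn₁, h₁, hc₁, hk⟩ := h.addEdge_sound hc hx hyn hxy'
    (by rw [hc.dart y (by omega) x (by omega), hkn]; tauto) hk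
  obtain ⟨kn₂, r₂, R₂, hkn₂, h₂, hc₂, hk⟩ := h₁.addEdge_sound hc₁ hv hyn hvy
    (by rw [hc.dart v (by omega) y (by omega), hkn₁, hkn]; tauto) hk
  have e1 := hT.rot hadj.symm
  have e2 := hT.rot' hadj.symm
  rw [hy] at e1 e2
  have h₃ := h₂.addFace (v := v) (x := x) (y := y) (by rw [hkn₂, hkn₁]; tauto)
    (by rw [hkn₂, hkn₁]; tauto) (by rw [hkn₂]; tauto) hy e1 e2
  have hc₃ : Code n (fun p q ↦ d p q ∨ (p = v ∧ q = x) ∨ (p = x ∧ q = y) ∨ (p = y ∧ q = v)) r₂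
      (setEntry (setEntry (setEntry D v x) x y) y v)
      (setEntry (setEntry (setEntry E x v) y x) v y) R₂ := by
    refine ⟨fun i hi j hj ↦ ?_, fun i hi j hj ↦ ?_, hc₂.lt, hc₂.sum⟩
    · rw [entry_setEntry _ (by omega) hj, entry_setEntry _ (by omega) hj,
        entry_setEntry _ (by omega) hj]
      simp only [Bool.or_eq_true, hc.dart i hi j hj, decide_eq_true_eq]
      tauto
    · rw [entry_setEntry _ (by omega) hj, entry_setEntry _ (by omega) hj,
        entry_setEntry _ (by omega) hj]
      simp only [Bool.or_eq_true, hc.dart' i hi j hj, decide_eq_true_eq]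
      tauto
  simp only [force_eq] at hk
  rw [h₃.closedOk hT hS hc₃ (q := v) (j := x) (by tauto),
    h₃.closedOk hT hS hc₃ (q := x) (j := y) (by tauto),
    h₃.closedOk hT hS hc₃ (q := y) (j := v) (by tauto)] at hk
  refine ⟨_, _, _, _, _, _, h₃, fun i j ↦ ?_, hc₃, ⟨x, v, .inl hxv⟩, hk⟩
  rw [hkn₂, hkn₁, hkn]
  grind

theorem Code.extend {D E R : ℕ} (h : Code n d r D E R) {c : ℕ} (hc : c < 16) :
    Code (n + 1) d (Function.update r n c) D E (R + c * 16 ^ n) := by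
  refine ⟨h.dart, h.dart', fun i hi ↦ ?_, ?_⟩
  · rcases eq_or_ne i n with rfl | hin
    · simpa
    · simpa [hin] using h.lt i (by omega)
  · rw [h.sum, Finset.sum_range_succ, Function.update_self]
    congr 1
    exact Finset.sum_congr rfl fun i hi ↦ by
      rw [Function.update_of_ne (Finset.mem_range.1 hi).ne]

theorem Partial.search_sound (hT : Tri T σ) (hS : S.card = 19)
    (hTS : ∀ u v, T.Adj u v → v ∈ S)
    (hconn : ∀ K ⊆ S, K.Nonempty → (∀ u ∈ K, ∀ v, T.Adj u v → v ∈ K) → 19 ≤ K.card)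
    {fuel D E R : ℕ} (h : Partial T σ S f n a b d kn r) (hkn : ∀ i j, kn i j ↔ d i j ∨ d j i)
    (hc : Code n d r D E R) (hd : ∃ i j, d i j) : search fuel n D E R a b ≠ true := by
  intro hs
  induction fuel generalizing f n a b d kn r D E R with
  | zero => exact absurd hs (by simp [search])
  | succ fuel ih =>
    have hn := h.le
    change searchStep (search fuel) n D E R a b = true at hs
    rw [searchStep, branch_eq_true] at hs
    rcases hs with ⟨h1, h2⟩ | ⟨-, hs⟩
    · have hsymm : ∀ i j, d i j → d j i := fun i j hij ↦ by
        obtain ⟨hi, hj, -⟩ := h.known _ _ (h.face _ _ hij).1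
        have h3 := (hc.dart' j (by omega) i (by omega)).2 hij
        rw [← hc.dart j (by omega) i (by omega), entry_eq]
        rw [← Nat.eq_of_beq_eq_true h1, entry_eq] at h3
        change (D &&& E).testBit _ = true at h3
        rw [Nat.testBit_and, Bool.and_eq_true] at h3
        exact h3.1
      have h4 := hconn (((Finset.range n).filter fun i ↦ ∃ j, d i j).image f) ?_ ?_ ?_
      · have h5 := h4.trans (Finset.card_image_le.trans (Finset.card_filter_le _ _))
        rw [Finset.card_range] at h5
        have := Nat.le_of_ble_eq_true h2
        omega
      · intro z hz
        obtain ⟨i, hi, rfl⟩ := Finset.mem_image.1 hz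
        exact h.mem i (Finset.mem_range.1 (Finset.mem_filter.1 hi).1)
      · obtain ⟨i, j, hij⟩ := hd
        exact ⟨f i, Finset.mem_image_of_mem f
          (by simpa using ⟨(h.known _ _ (h.face _ _ hij).1).1, j, hij⟩)⟩
      · intro u hu z hz
        obtain ⟨i, hi, rfl⟩ := Finset.mem_image.1 hu
        obtain ⟨-, j, hj⟩ := Finset.mem_filter.1 hi
        obtain ⟨k, hk, rfl⟩ := h.exists_of_closed hT (fun t ht ↦ hsymm _ _ ht) hj hz
        exact Finset.mem_image_of_mem f
          (by simpa using ⟨(h.known _ _ (h.face _ _ hk).1).2.1, i, hsymm _ _ hk⟩)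
    · obtain ⟨v, hs⟩ := exists_of_choose hs
      rw [force_eq] at hs
      generalize Nat.log2 _ = x at hs
      simp only [branch_eq_true, force_eq, Bool.false_eq_true, and_false, or_false, false_or] at hs
      obtain ⟨hv, hx, hxv, hvx, hnew, hold⟩ := hs
      replace hv := Nat.le_of_ble_eq_true hv
      replace hx := Nat.le_of_ble_eq_true hx
      rw [hc.dart x (by omega) v (by omega)] at hxv
      rw [← Bool.not_eq_true, hc.dart v (by omega) x (by omega)] at hvx
      have hadj := (h.known _ _ (h.face _ _ hxv).1).2.2.1.symm
      by_cases hy : ∃ y < n, σ (f v) (f x) = f y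
      · obtain ⟨y, hyn, hy⟩ := hy
        have h3 := h.third hT hxv hvx hy
        have h4 :
            entry (setEntry (setEntry (Nat.lor (row D x) (row E v)) 0 v) 0 x) 0 y = false := by
          have h5 : (Nat.lor (row D x) (row E v)).testBit (32 * 0 + y) = false := by
            change (row D x ||| row E v).testBit _ = false
            rw [Nat.testBit_or, Nat.mul_zero, Nat.zero_add, testBit_row _ _ _ (by omega),
              testBit_row _ _ _ (by omega), ← entry_eq, ← entry_eq, Bool.or_eq_false_iff,
              ← Bool.not_eq_true, ← Bool.not_eq_true, hc.dart x (by omega) y (by omega),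
              hc.dart' v (by omega) y (by omega)]
            exact h3.2.2
          rw [entry_setEntry _ (by omega) (by omega), entry_setEntry _ (by omega) (by omega),
            entry_eq, h5]
          simp [h3.1, h3.2.1]
        have h5 := of_forallLT hold hyn
        rw [branch_eq_true, h4] at h5
        obtain ⟨d', kn', r', D', E', R', h₁, hkn₁, hc₁, hd₁, hs⟩ :=
          h.addFace_sound hT (by omega) hkn hc hxv hvx hy hyn (by simpa using h5)
        exact ih h₁ hkn₁ hc₁ hd₁ hs
      · push Not at hy
        have hzS := hTS _ _ (hT.adj hadj)
        have hv0 := h.pos hv (hT.adj hadj) fun t ht e ↦ hy t (h.known _ _ ht).2.1 e.symm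
        rw [hc.digit hv] at hnew
        replace hnew := (hnew.resolve_left fun e ↦ hv0.ne' (Nat.eq_of_beq_eq_true e.1)).2
        have step : ∀ {c a' b' : ℕ}, c < 16 → (nb T Finset.univ (σ (f v) (f x))).card = c →
            (a ≤ a' + if (nb T Finset.univ (σ (f v) (f x))).card = 7 then 1 else 0) →
            (b ≤ b' + if (nb T Finset.univ (σ (f v) (f x))).card = 5 then 1 else 0) →
            PlanarSeq.addFace D E (R + c * 16 ^ n) v x n
              (fun D E R ↦ search fuel (n + 1) D E R a' b') = true → False := by
          intro c a' b' hc16 hcz ha hb hs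
          have h₁ := h.extend hzS (fun i hi e ↦ hy i hi e.symm)
            (f' := Function.update f n (σ (f v) (f x))) (r' := Function.update r n c)
            (fun i hi ↦ Function.update_of_ne hi.ne _ _) (Function.update_self _ _ _)
            (fun i hi ↦ Function.update_of_ne hi.ne _ _)
            (by rw [Function.update_self, hcz]) ha hb
          obtain ⟨d', kn', r', D', E', R', h₁, hkn₁, hc₁, hd₁, hs⟩ :=
            h₁.addFace_sound hT (by omega) hkn (hc.extend hc16) hxv hvx
              (by rw [Function.update_self, Function.update_of_ne (by omega),
                Function.update_of_ne (by omega)]) (Nat.lt_succ_self n) hs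
          exact ih h₁ hkn₁ hc₁ hd₁ hs
        rcases h.seven_or_five _ hzS (fun i hi e ↦ hy i hi e.symm) with h7 | h5
        · have ha : 0 < a := (Finset.card_pos.2 ⟨σ (f v) (f x), by
            simpa [hzS, h7] using fun i hi e ↦ hy i hi e.symm⟩).trans_le h.seven
          refine step (by norm_num) h7 (a' := a - 1) (b' := b) (by simp [h7]; omega) (by simp) ?_
          exact (hnew.1.resolve_left fun e ↦ ha.ne' (Nat.eq_of_beq_eq_true e.1)).2
        · have hb : 0 < b := (Finset.card_pos.2 ⟨σ (f v) (f x), by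
            simpa [hzS, h5] using fun i hi e ↦ hy i hi e.symm⟩).trans_le h.five
          refine step (by norm_num) h5 (a' := a) (b' := b - 1) (by simp) (by simp [h5]; omega) ?_
          exact (hnew.2.resolve_left fun e ↦ hb.ne' (Nat.eq_of_beq_eq_true e.1)).2

end Sound

end Search

end PlanarSeq

namespace PlanarSeq

section Contraction

/-- The search fails from a face `0 1 2`; here `i`, `j`, `k` are the numbers of vertices of degree 7
among the contracted edge, the vertex 1 and the vertex 2. -/
theorem search_eq_true : ∀ i < 3, ∀ j < 2, ∀ k < 2, i + j + k ≤ 3 →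
    search 40 3 (2 ^ 1 + 2 ^ 34 + 2 ^ 64) (2 ^ 32 + 2 ^ 65 + 2 ^ 2)
      ((5 + 2 * i) + (2 + 2 * j) * 16 + (3 + 2 * k) * 256) (3 - i - j - k) (13 + i + j + k) =
    true := by
  decide +kernel

open scoped Classical

variable {V : Type*} [Fintype V] {G : SimpleGraph V}

/-- The degrees in `G` and in the graph obtained by contracting an edge. -/
theorem card_nb_hub_pair {u v x : V} (huv : G.Adj u v)
    (hcom : ∀ y, G.Adj u y ∧ G.Adj v y ↔ y = x) :
    (nb (hub G {u, v} u) Finset.univ u).card + 3 =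
      (nb G Finset.univ u).card + (nb G Finset.univ v).card ∧
    (nb (hub G {u, v} u) Finset.univ x).card + 1 = (nb G Finset.univ x).card ∧
    ∀ z, z ≠ u → z ≠ v → z ≠ x →
      (nb (hub G {u, v} u) Finset.univ z).card = (nb G Finset.univ z).card := by
  have hx := (hcom x).2 rfl
  have hv : ∀ z, ¬ (hub G {u, v} u).Adj z v := fun z h ↦ (hub_pair_ne huv.ne h).2 rfl
  refine ⟨?_, ?_, ?_⟩
  · have h1 := nb_inter_card (G := G) Finset.univ u v
    have h2 : nb G (nb G Finset.univ u) v = {x} := by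
      ext z
      simpa using hcom z
    have h3 : ({z ∈ Finset.univ | G.Adj u z ∨ G.Adj v z} : Finset V) =
        insert u (insert v (nb (hub G {u, v} u) Finset.univ u)) := by
      ext z
      simp only [Finset.mem_filter, Finset.mem_univ, true_and, Finset.mem_insert, mem_nb]
      by_cases hzu : z = u
      · simp [hzu, huv.symm]
      by_cases hzv : z = v
      · simp [hzv, huv]
      simp [hzu, hzv, hub_pair_adj_left hzu hzv]
    have h4 : u ∉ insert v (nb (hub G {u, v} u) Finset.univ u) := by simp [huv.ne]
    have h5 : v ∉ nb (hub G {u, v} u) Finset.univ u := by simp [hv]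
    rw [h3, h2, Finset.card_insert_of_notMem h4, Finset.card_insert_of_notMem h5] at h1
    simp only [Finset.card_singleton] at h1
    omega
  · have h1 : nb G Finset.univ x = insert v (nb (hub G {u, v} u) Finset.univ x) := by
      ext z
      simp only [Finset.mem_univ, true_and, Finset.mem_insert, mem_nb]
      by_cases hzu : z = u
      · subst hzu
        rw [(hub G {z, v} z).adj_comm, hub_pair_adj_left hx.1.ne' hx.2.ne']
        simp [hx.1.symm, hx.1]
      by_cases hzv : z = v
      · simp [hzv, hx.2.symm]
      simp [hzv, hub_pair_adj hx.1.ne' hx.2.ne' hzu hzv]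
    rw [h1, Finset.card_insert_of_notMem (by simp [hv])]
  · intro z hzu hzv hzx
    have hadj : (hub G {u, v} u).Adj z u ↔ G.Adj z u ∨ G.Adj z v := by
      rw [(hub G {u, v} u).adj_comm, hub_pair_adj_left hzu hzv, G.adj_comm u, G.adj_comm v]
    have hnot : ¬ (G.Adj z u ∧ G.Adj z v) := fun h ↦ hzx ((hcom z).1 ⟨h.1.symm, h.2.symm⟩)
    refine Finset.card_bij' (fun w _ ↦ if w = u ∧ G.Adj z v then v else w)
      (fun w _ ↦ if w = v then u else w) ?_ ?_ ?_ ?_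
    · intro w hw
      have hw := (mem_nb.1 hw).2
      simp only [mem_nb, Finset.mem_univ, true_and]
      split_ifs with h
      · exact h.2
      · by_cases hwu : w = u
        · subst hwu
          tauto
        · exact (hub_pair_adj hzu hzv hwu fun e ↦ hv z (e ▸ hw)).1 hw
    · intro w hw
      have hw := (mem_nb.1 hw).2
      simp only [mem_nb, Finset.mem_univ, true_and]
      split_ifs with h
      · exact hadj.2 (.inr (h ▸ hw))
      · by_cases hwu : w = u
        · rw [hwu] at hw ⊢
          exact hadj.2 (.inl hw)
        · exact (hub_pair_adj hzu hzv hwu h).2 hw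
    · intro w hw
      have hw := (mem_nb.1 hw).2
      have : w ≠ v := fun e ↦ hv z (e ▸ hw)
      grind
    · intro w hw
      have hw := (mem_nb.1 hw).2
      grind [huv.ne]

/-- A set closed under adjacency in a triangulation on 19 vertices is everything. -/
theorem HT.card_le_of_closed {T : SimpleGraph V} (hT : HT T) {S : Finset V} (hS : S.card = 19)
    (hTS : ∀ u v, T.Adj u v → u ∈ S ∧ v ∈ S) (he : e T S S = 102)
    (hdeg : ∀ z ∈ S, 4 ≤ (nb T Finset.univ z).card) (K : Finset V) (hKS : K ⊆ S)
    (hK : K.Nonempty) (hcl : ∀ u ∈ K, ∀ v, T.Adj u v → v ∈ K) : 19 ≤ K.card := by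
  by_contra! hlt
  have large : ∀ L ⊆ S, L.Nonempty → (∀ u ∈ L, ∀ v, T.Adj u v → v ∈ L) → 3 ≤ L.card := by
    intro L hLS ⟨z, hz⟩ hcl
    refine le_trans ?_ (Finset.card_le_card (s := nb T Finset.univ z) fun w hw ↦
      hcl z hz w (mem_nb.1 hw).2)
    exact le_trans (by norm_num) (hdeg z (hLS hz))
  have hL : (S \ K).Nonempty := by
    rw [Finset.sdiff_nonempty]
    intro h
    have := Finset.card_le_card h
    omega
  have hcl' : ∀ u ∈ S \ K, ∀ v, T.Adj u v → v ∈ S \ K := by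
    intro u hu v huv
    rw [Finset.mem_sdiff] at hu ⊢
    exact ⟨(hTS u v huv).2, fun h ↦ hu.2 (hcl v h u huv.symm)⟩
  have h1 := hT.edge_bound (large K hKS hK hcl)
  have h2 := hT.edge_bound (large _ Finset.sdiff_subset hL hcl')
  have h3 := e_union (G := T) (A := K) (B := S \ K) Finset.disjoint_sdiff
  have h4 : e T K (S \ K) = 0 := by
    rw [e_eq_sum_card, Finset.sum_eq_zero]
    intro z hz
    rw [Finset.card_eq_zero, Finset.eq_empty_iff_forall_notMem]
    intro w hw
    rw [mem_nb, Finset.mem_sdiff] at hw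
    exact hw.1.2 (hcl z hz w hw.2)
  rw [Finset.union_sdiff_of_subset hKS, he, h4] at h3
  have h5 := Finset.card_sdiff_add_card_eq_card hKS
  omega

theorem HT.false_of_degrees (hG : HT G) (hV : Fintype.card V = 20) {c : V → ℕ}
    (hc : ∀ z, c z < 2) (hcs : ∑ z, c z = 3)
    (hdeg : ∀ z, (nb G Finset.univ z).card = 5 + 2 * c z) : False := by
  have he : e G Finset.univ Finset.univ = 106 := by
    rw [e_eq_sum_card]
    simp only [hdeg, Finset.sum_add_distrib, ← Finset.mul_sum, hcs]
    simp [hV]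
  obtain ⟨u, v, x, huv, hcom⟩ := hG.exists_unique_common hV (fun a ↦ by rw [hdeg]; omega) he
  have hx := (hcom x).2 rfl
  obtain ⟨hdu, hdx, hdz⟩ := card_nb_hub_pair huv hcom
  obtain ⟨T, hTdef⟩ : ∃ T, T = hub G {u, v} u := ⟨_, rfl⟩
  have hux : T.Adj u x := by
    rw [hTdef, hub_pair_adj_left hx.1.ne' hx.2.ne']
    exact .inl hx.1
  have hTv : ∀ a b, T.Adj a b → a ≠ v ∧ b ≠ v := fun a b h ↦ by
    rw [hTdef] at h
    exact hub_pair_ne huv.ne h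
  have hT : HT T := by
    rw [hTdef]
    exact hG.ht_hub ((conn_singleton v).insert rfl huv) (by simp)
  have hS : ((Finset.univ : Finset V).erase v).card = 19 := by
    rw [Finset.card_erase_of_mem (Finset.mem_univ v), Finset.card_univ, hV]
  have hTS : ∀ a b, T.Adj a b → a ∈ Finset.univ.erase v ∧ b ∈ Finset.univ.erase v := fun a b h ↦ by
    simpa using hTv a b h
  have heT : e T (Finset.univ.erase v) (Finset.univ.erase v) = 102 := by
    have huv' : u ∈ Finset.univ.erase v := by simp [huv.ne]
    have h1 := e_hub_pair (G := G) (Y := (Finset.univ.erase v).erase u) huv (by simp) (by simp)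
    have h2 : nb G (nb G ((Finset.univ.erase v).erase u) u) v = {x} := by
      ext z
      simp only [mem_nb, Finset.mem_erase, Finset.mem_univ, Finset.mem_singleton, ← hcom z]
      exact ⟨fun h ↦ ⟨h.1.2, h.2⟩, fun h ↦ ⟨⟨⟨h.1.ne', h.2.ne', trivial⟩, h.1⟩, h.2⟩⟩
    rw [Finset.insert_comm u v, Finset.insert_erase huv', Finset.insert_erase (Finset.mem_univ v),
      he, h2, ← hTdef, Finset.card_singleton] at h1
    omega
  rw [← hTdef] at hdu hdx hdz
  simp only [hdeg] at hdu hdx hdz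
  obtain ⟨σ, hσ⟩ := exists_tri 19 (by norm_num) T _ hS hTS hT (by rw [heT])
  obtain ⟨y, hy⟩ : ∃ y, y = σ u x := ⟨_, rfl⟩
  have huy := hσ.adj hux
  have hxy := hσ.adj' hux
  rw [← hy] at huy hxy
  have hyv := (hTv _ _ huy).2
  have hW : ∀ g : V → ℕ, ∑ z ∈ {u, v, x, y}, g z = g u + g v + g x + g y := by
    intro g
    rw [Finset.sum_insert (by simp [huv.ne, hux.ne, huy.ne]),
      Finset.sum_insert (by simp [hx.2.ne, hyv.symm]), Finset.sum_pair hxy.ne]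
    ring
  have hsum : ∑ z ∈ Finset.univ \ {u, v, x, y}, c z + (c u + c v + c x + c y) = 3 := by
    rw [← hW, Finset.sum_sdiff (Finset.subset_univ _), hcs]
  have hcard : ((Finset.univ : Finset V) \ {u, v, x, y}).card + 4 = 20 := by
    have := hW fun _ ↦ 1
    rw [Finset.sum_const, smul_eq_mul, mul_one] at this
    have h := Finset.card_sdiff_add_card_eq_card (Finset.subset_univ ({u, v, x, y} : Finset V))
    rw [Finset.card_univ, hV] at h
    omega
  have h7 : ((Finset.univ \ {u, v, x, y}).filter fun z ↦ c z = 1).card =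
      ∑ z ∈ Finset.univ \ {u, v, x, y}, c z := by
    rw [Finset.card_filter]
    refine Finset.sum_congr rfl fun z _ ↦ ?_
    have := hc z
    split_ifs <;> omega
  have h5 : ((Finset.univ \ {u, v, x, y}).filter fun z ↦ c z = 0).card +
      ∑ z ∈ Finset.univ \ {u, v, x, y}, c z = ((Finset.univ : Finset V) \ {u, v, x, y}).card := by
    rw [Finset.card_filter, ← Finset.sum_add_distrib, Finset.card_eq_sum_ones]
    refine Finset.sum_congr rfl fun z _ ↦ ?_
    have := hc z
    split_ifs <;> omega
  have hcu := hc u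
  have hcv := hc v
  have hcx := hc x
  have hcy := hc y
  have hdy := hdz y huy.ne' hyv hxy.ne'
  let f : ℕ → V := fun i ↦ if i = 0 then u else if i = 1 then x else y
  let r : ℕ → ℕ := fun i ↦
    if i = 0 then 5 + 2 * (c u + c v) else if i = 1 then 2 + 2 * c x else 3 + 2 * c y
  let d : ℕ → ℕ → Prop := fun i j ↦ (i = 0 ∧ j = 1) ∨ (i = 1 ∧ j = 2) ∨ (i = 2 ∧ j = 0)
  have hold : ∀ z, (∀ i < 3, f i ≠ z) ↔ u ≠ z ∧ x ≠ z ∧ y ≠ z := by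
    intro z
    refine ⟨fun h ↦ ⟨h 0 (by norm_num), h 1 (by norm_num), h 2 (by norm_num)⟩, ?_⟩
    rintro ⟨h0, h1, h2⟩ i hi
    interval_cases i <;> simpa [f]
  have hdz' : ∀ z ∈ Finset.univ.erase v, (∀ i < 3, f i ≠ z) →
      (nb T Finset.univ z).card = 5 + 2 * c z := by
    intro z hz hz'
    rw [hold] at hz'
    exact hdz z hz'.1.symm (Finset.mem_erase.1 hz).1 hz'.2.1.symm
  have key : ∀ (m : ℕ) (A : Finset V), (∀ z ∈ A, z ∈ Finset.univ.erase v ∧ (∀ i < 3, f i ≠ z) ∧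
      (nb T Finset.univ z).card = 5 + 2 * m) →
      A.card ≤ ((Finset.univ \ {u, v, x, y}).filter fun z ↦ c z = m).card := by
    intro m A hA
    refine Finset.card_le_card fun z hz ↦ ?_
    obtain ⟨hz1, hz2, hz3⟩ := hA z hz
    rw [hdz' z hz1 hz2] at hz3
    rw [hold] at hz2
    have hzv := (Finset.mem_erase.1 hz1).1
    simp only [Finset.mem_filter, Finset.mem_sdiff, Finset.mem_univ, true_and, Finset.mem_insert,
      Finset.mem_singleton]
    refine ⟨?_, by omega⟩
    rintro (h | h | h | h)
    exacts [hz2.1 h.symm, hzv h, hz2.2.1 h.symm, hz2.2.2 h.symm]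
  have hP : Partial T σ (Finset.univ.erase v) f 3 (3 - (c u + c v) - c x - c y)
      (13 + (c u + c v) + c x + c y) d (fun i j ↦ d i j ∨ d j i) r := by
    refine ⟨?_, ?_, ?_, ?_, ?_, (key 1 _ fun z hz ↦ Finset.mem_filter.1 hz).trans ?_,
      (key 0 _ fun z hz ↦ Finset.mem_filter.1 hz).trans ?_, ?_⟩
    · intro i hi j hj hij
      have := hux.ne
      have := huy.ne
      have := hxy.ne
      simp only [f] at hij
      grind
    · intro i hi
      simp only [f, Finset.mem_erase, Finset.mem_univ, and_true]
      have := huv.ne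
      have := hx.2.ne'
      split_ifs <;> assumption
    · have h1 := hux.symm
      have h2 := huy.symm
      have h3 := hxy.symm
      rintro i j ((⟨rfl, rfl⟩ | ⟨rfl, rfl⟩ | ⟨rfl, rfl⟩) |
        (⟨rfl, rfl⟩ | ⟨rfl, rfl⟩ | ⟨rfl, rfl⟩)) <;>
        simp [f, d, hux, huy, hxy, h1, h2, h3]
    · have h1 := hσ.rot hux
      have h2 := hσ.rot' hux
      rw [← hy] at h1 h2
      rintro i j (⟨rfl, rfl⟩ | ⟨rfl, rfl⟩ | ⟨rfl, rfl⟩)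
      · exact ⟨by simp [d], 2, by simp [f, d, hy]⟩
      · exact ⟨by simp [d], 0, by simp [f, d, h1]⟩
      · exact ⟨by simp [d], 1, by simp [f, d, h2]⟩
    · intro i hi
      have h2 : ∀ A : Finset ℕ, (∀ j, j ∈ A ↔ j ∈ Finset.range 3 ∧ (d i j ∨ d j i)) →
          A.card = 2 := by
        intro A hA
        have e : A = (Finset.range 3).erase i := by
          ext j
          rw [hA, Finset.mem_erase, Finset.mem_range]
          simp only [d]
          omega
        rw [e, Finset.card_erase_of_mem (Finset.mem_range.2 hi), Finset.card_range]
      have h3 : r i + 2 = (nb T Finset.univ (f i)).card := by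
        interval_cases i <;> simp [f, r] <;> omega
      rw [← h3]
      refine congrArg (r i + ·) (h2 _ fun j ↦ ?_)
      exact @Finset.mem_filter _ _ (_) _ _
    · rw [h7]
      omega
    · omega
    · intro z hz hz'
      rw [hdz' z hz hz']
      have := hc z
      omega
  have hC : Code 3 d r (2 ^ 1 + 2 ^ 34 + 2 ^ 64) (2 ^ 32 + 2 ^ 65 + 2 ^ 2)
      ((5 + 2 * (c u + c v)) + (2 + 2 * c x) * 16 + (3 + 2 * c y) * 256) := by
    refine ⟨?_, ?_, ?_, ?_⟩
    · have : ∀ i < 32, ∀ j < 32, entry (2 ^ 1 + 2 ^ 34 + 2 ^ 64) i j = true ↔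
          (i = 0 ∧ j = 1) ∨ (i = 1 ∧ j = 2) ∨ (i = 2 ∧ j = 0) := by decide +kernel
      exact this
    · have : ∀ i < 32, ∀ j < 32, entry (2 ^ 32 + 2 ^ 65 + 2 ^ 2) i j = true ↔
          (j = 0 ∧ i = 1) ∨ (j = 1 ∧ i = 2) ∨ (j = 2 ∧ i = 0) := by decide +kernel
      exact this
    · intro i _
      simp only [r]
      split_ifs <;> omega
    · simp [Finset.sum_range_succ, r]
  refine hP.search_sound hσ hS (fun a b h ↦ (hTS a b h).2)
    (hT.card_le_of_closed hS hTS heT ?_) (fun _ _ ↦ Iff.rfl) hC ⟨0, 1, by simp [d]⟩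
    (search_eq_true (c u + c v) (by omega) (c x) hcx (c y) hcy (by omega))
  intro z hz
  by_cases hzu : z = u
  · rw [hzu]; omega
  by_cases hzx : z = x
  · rw [hzx]; omega
  rw [hdz z hzu (Finset.mem_erase.1 hz).1 hzx]
  omega

end Contraction

end PlanarSeq

/-- The degree sequence `7^3 5^17` (three 7's and seventeen 5's, on 20 vertices)
is not planar graphical: no simple planar graph has this degree sequence.
This resolves the last open case of the Schmeichel–Hakimi conjecture. -/
theorem seq_7_3_5_17_not_planar_graphical :
    ¬ ∃ G : SimpleGraph (Fin 20), G.IsPlanar ∧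
      Multiset.map (fun v => (G.neighborSet v).ncard) Finset.univ.val =
        Multiset.replicate 3 7 + Multiset.replicate 17 5 := by
  classical
  rintro ⟨G, hG, hm⟩
  have hd : ∀ v, (G.neighborSet v).ncard = (PlanarSeq.nb G Finset.univ v).card := by
    intro v
    rw [← Set.ncard_coe_finset]
    congr 1
    ext x
    rw [SimpleGraph.mem_neighborSet, Finset.mem_coe, PlanarSeq.mem_nb]
    exact (and_iff_right (Finset.mem_univ x)).symm
  simp only [hd] at hm
  have hmem : ∀ v, (PlanarSeq.nb G Finset.univ v).card = 7 ∨
      (PlanarSeq.nb G Finset.univ v).card = 5 := by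
    intro v
    have h := Multiset.mem_map_of_mem (fun v ↦ (PlanarSeq.nb G Finset.univ v).card)
      (Finset.mem_univ_val v)
    rw [hm, Multiset.mem_add] at h
    exact h.imp Multiset.eq_of_mem_replicate Multiset.eq_of_mem_replicate
  have hsum : ∑ v, (PlanarSeq.nb G Finset.univ v).card = 106 := by
    have h := congrArg Multiset.sum hm
    rwa [Multiset.sum_add, Multiset.sum_replicate, Multiset.sum_replicate] at h
  have hdeg : ∀ v, (PlanarSeq.nb G Finset.univ v).card =
      5 + 2 * (((PlanarSeq.nb G Finset.univ v).card - 5) / 2) := fun v ↦ by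
    have := hmem v
    omega
  refine (PlanarSeq.ht_of_isPlanar hG).false_of_degrees (by simp)
    (c := fun v ↦ ((PlanarSeq.nb G Finset.univ v).card - 5) / 2) (fun v ↦ ?_) ?_ hdeg
  · have := hmem v
    omega
  · rw [Finset.sum_congr rfl fun v _ ↦ hdeg v, Finset.sum_add_distrib, ← Finset.mul_sum] at hsum
    simp only [Finset.sum_const, Finset.card_univ, Fintype.card_fin, smul_eq_mul] at hsum
    omega
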